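/- Every finite family of disks whose total area is at most half the area of the unit disk can be packed into the unit disk: if (r_i)_{i ∈ I} is a finite family of positive reals with ∑_{i ∈ I} π·r_i² ≤ π/2, then there exist centers c_i ∈ ℝ² with ‖c_i‖ ≤ 1 − r_i for every i ∈ I and ‖c_i − c_j‖ ≥ r_i + r_j for all i ≠ j. -/

import Mathlib

open Real

/-- Integer polynomial expressions in three variables. -/
inductive PExpr where
  | c (n : ℤ)
  | x (i : Fin 3)
  | add (p q : PExpr)
  | sub (p q : PExpr)
  | mul (p q : PExpr)

namespace PExpr

instance : Add PExpr := ⟨add⟩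
instance : Sub PExpr := ⟨sub⟩
instance : Mul PExpr := ⟨mul⟩

/-- Evaluation in a commutative ring. -/
def eval {R : Type*} [CommRing R] (v : Fin 3 → R) : PExpr → R
  | c n => n
  | x i => v i
  | add p q => eval v p + eval v q
  | sub p q => eval v p - eval v q
  | mul p q => eval v p * eval v q

/-- A bound for the degree in the `i`-th variable. -/
def deg (i : Fin 3) : PExpr → ℕ
  | c _ => 0
  | x j => if j = i then 1 else 0
  | add p q => max (deg i p) (deg i q)
  | sub p q => max (deg i p) (deg i q)
  | mul p q => deg i p + deg i q

/-- The factor `∏ u i ^ (deg i q - deg i p)` which makes `p` homogeneous of the degree of `q`. -/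
def padding {R : Type*} [CommSemiring R] (u : Fin 3 → R) (p q : PExpr) : R :=
  ∏ i, u i ^ (deg i q - deg i p)

/-- Evaluation of the multihomogeneous version of an expression. -/
def evalHom {R : Type*} [CommRing R] (a u : Fin 3 → R) : PExpr → R
  | c n => n
  | x i => a i
  | add p q => padding u p q * evalHom a u p + padding u q p * evalHom a u q
  | sub p q => padding u p q * evalHom a u p - padding u q p * evalHom a u q
  | mul p q => evalHom a u p * evalHom a u q

theorem evalHom_eq {R : Type*} [Field R] (v u : Fin 3 → R) (p : PExpr) :
    evalHom (fun i => u i * v i) u p = (∏ i, u i ^ deg i p) * eval v p := by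
  have key : ∀ p q : PExpr, (∏ i, u i ^ max (deg i p) (deg i q)) =
      padding u p q * ∏ i, u i ^ deg i p := by
    intro p q
    rw [padding, ← Finset.prod_mul_distrib]
    refine Finset.prod_congr rfl fun i _ => ?_
    rw [← pow_add]; congr 1; omega
  induction p with
  | c n => simp [evalHom, deg, eval]
  | x i => simp [evalHom, deg, eval, Finset.prod_ite_eq]
  | add p q hp hq =>
    simp only [evalHom, deg, eval, hp, hq, mul_add]
    rw [← mul_assoc, ← mul_assoc, ← key, ← key]; simp only [max_comm]
  | sub p q hp hq =>
    simp only [evalHom, deg, eval, hp, hq, mul_sub]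
    rw [← mul_assoc, ← mul_assoc, ← key, ← key]; simp only [max_comm]
  | mul p q hp hq =>
    simp only [evalHom, deg, eval, hp, hq, pow_add, Finset.prod_mul_distrib]; ring

theorem map_evalHom {R S : Type*} [CommRing R] [CommRing S] (f : R →+* S) (a u : Fin 3 → R)
    (p : PExpr) : f (evalHom a u p) = evalHom (fun i => f (a i)) (fun i => f (u i)) p := by
  induction p with
  | c n => simp [evalHom]
  | x i => simp [evalHom]
  | add p q hp hq => simp [evalHom, hp, hq, padding]
  | sub p q hp hq => simp [evalHom, hp, hq, padding]
  | mul p q hp hq => simp [evalHom, hp, hq]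

/-- Multiplication by `u ^ k`, in a form that reduces well in the kernel. -/
def padInt (u : ℤ) (k : ℕ) (n : ℤ) : ℤ := Nat.rec n (fun _ r => Int.mul u r) k

/-- Multiplication by `padding u p q`, in a form that reduces well in the kernel. -/
def padding' (u : Fin 3 → ℤ) (p q : PExpr) (n : ℤ) : ℤ :=
  padInt (u 0) (deg 0 q - deg 0 p) (padInt (u 1) (deg 1 q - deg 1 p)
    (padInt (u 2) (deg 2 q - deg 2 p) n))

/-- A version of `evalHom` over the integers that reduces well in the kernel. -/
def evalInt (a u : Fin 3 → ℤ) : PExpr → ℤ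
  | c n => n
  | x i => a i
  | add p q => Int.add (padding' u p q (evalInt a u p)) (padding' u q p (evalInt a u q))
  | sub p q => Int.sub (padding' u p q (evalInt a u p)) (padding' u q p (evalInt a u q))
  | mul p q => Int.mul (evalInt a u p) (evalInt a u q)

theorem padInt_eq (u : ℤ) (k : ℕ) (n : ℤ) : padInt u k n = u ^ k * n := by
  induction k with
  | zero => simp [padInt]
  | succ k ih =>
    rw [pow_succ', mul_assoc, ← ih]; rfl

theorem padding'_eq (u : Fin 3 → ℤ) (p q : PExpr) (n : ℤ) :
    padding' u p q n = padding u p q * n := by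
  simp only [padding', padInt_eq, padding, Fin.prod_univ_three]; ring

theorem evalInt_eq (a u : Fin 3 → ℤ) (p : PExpr) : evalInt a u p = evalHom a u p := by
  induction p with
  | c n => simp [evalInt, evalHom]
  | x i => rfl
  | add p q hp hq => simp only [evalInt, evalHom, ← hp, ← hq, ← padding'_eq]; rfl
  | sub p q hp hq => simp only [evalInt, evalHom, ← hp, ← hq, ← padding'_eq]; rfl
  | mul p q hp hq => simp only [evalInt, evalHom, ← hp, ← hq]; rfl

/-- A majorant for the sum of the absolute values of the coefficients of `evalHom`. -/
def majorant (a u : Fin 3 → ℤ) : PExpr → ℤ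
  | c n => |n|
  | x i => a i
  | add p q => padding' u p q (majorant a u p) + padding' u q p (majorant a u q)
  | sub p q => padding' u p q (majorant a u p) + padding' u q p (majorant a u q)
  | mul p q => majorant a u p * majorant a u q

end PExpr

namespace MvPolynomial

variable {σ : Type*}

/-- The sum of the absolute values of the coefficients. -/
def coeffNorm (p : MvPolynomial σ ℤ) : ℤ := ∑ m ∈ p.support, |p.coeff m|

theorem coeffNorm_eq_of_support_subset {p : MvPolynomial σ ℤ} {s : Finset (σ →₀ ℕ)}
    (h : p.support ⊆ s) : coeffNorm p = ∑ m ∈ s, |p.coeff m| :=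
  Finset.sum_subset h fun m _ hm => by simp [notMem_support_iff.1 hm]

theorem coeffNorm_nonneg (p : MvPolynomial σ ℤ) : 0 ≤ coeffNorm p :=
  Finset.sum_nonneg fun _ _ => abs_nonneg _

theorem coeffNorm_add_le (p q : MvPolynomial σ ℤ) :
    coeffNorm (p + q) ≤ coeffNorm p + coeffNorm q := by
  classical
  rw [coeffNorm_eq_of_support_subset (p := p + q) support_add,
    coeffNorm_eq_of_support_subset (p := p) (s := p.support ∪ q.support)
      Finset.subset_union_left,
    coeffNorm_eq_of_support_subset (p := q) (s := p.support ∪ q.support)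
      Finset.subset_union_right, ← Finset.sum_add_distrib]
  exact Finset.sum_le_sum fun m _ => by rw [coeff_add]; exact abs_add_le _ _

theorem coeffNorm_neg (p : MvPolynomial σ ℤ) : coeffNorm (-p) = coeffNorm p := by
  simp [coeffNorm]

theorem coeffNorm_sub_le (p q : MvPolynomial σ ℤ) :
    coeffNorm (p - q) ≤ coeffNorm p + coeffNorm q := by
  rw [sub_eq_add_neg, ← coeffNorm_neg q]; exact coeffNorm_add_le _ _

theorem coeffNorm_sum_le {ι : Type*} (s : Finset ι) (f : ι → MvPolynomial σ ℤ) :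
    coeffNorm (∑ i ∈ s, f i) ≤ ∑ i ∈ s, coeffNorm (f i) :=
  Finset.le_sum_of_subadditive _ (by simp [coeffNorm]) coeffNorm_add_le _ _

theorem coeffNorm_monomial_le (m : σ →₀ ℕ) (a : ℤ) : coeffNorm (monomial m a) ≤ |a| := by
  classical
  rw [coeffNorm_eq_of_support_subset (s := {m}) (by
    rw [support_monomial]; split_ifs <;> simp)]
  simp

theorem coeffNorm_mul_le (p q : MvPolynomial σ ℤ) :
    coeffNorm (p * q) ≤ coeffNorm p * coeffNorm q := by
  have h : coeffNorm p * coeffNorm q =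
      ∑ m ∈ p.support, ∑ n ∈ q.support, |p.coeff m| * |q.coeff n| := Finset.sum_mul_sum ..
  rw [h, mul_def]
  refine (coeffNorm_sum_le _ _).trans (Finset.sum_le_sum fun m _ => ?_)
  refine (coeffNorm_sum_le _ _).trans (Finset.sum_le_sum fun n _ => ?_)
  rw [← abs_mul]
  exact coeffNorm_monomial_le _ _

theorem coeffNorm_C_le (a : ℤ) : coeffNorm (C a : MvPolynomial σ ℤ) ≤ |a| :=
  coeffNorm_monomial_le _ _

theorem coeffNorm_X_le (i : σ) : coeffNorm (X i : MvPolynomial σ ℤ) ≤ 1 :=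
  coeffNorm_monomial_le _ _

theorem coeffNorm_pow_le {p : MvPolynomial σ ℤ} {b : ℤ} (h : coeffNorm p ≤ b) (k : ℕ) :
    coeffNorm (p ^ k) ≤ b ^ k := by
  induction k with
  | zero => simpa using coeffNorm_C_le (σ := σ) 1
  | succ k ih =>
    rw [pow_succ, pow_succ]
    exact (coeffNorm_mul_le _ _).trans (mul_le_mul ih h (coeffNorm_nonneg _)
      ((coeffNorm_nonneg _).trans ih))

end MvPolynomial

namespace PExpr
open MvPolynomial

theorem coeffNorm_padding_mul_le {u : Fin 3 → MvPolynomial (Fin 3) ℤ} {u' : Fin 3 → ℤ}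
    (hu : ∀ i, coeffNorm (u i) ≤ u' i) (p q : PExpr) {g : MvPolynomial (Fin 3) ℤ} {n : ℤ}
    (hg : coeffNorm g ≤ n) : coeffNorm (padding u p q * g) ≤ padding' u' p q n := by
  rw [padding'_eq, padding, padding, Fin.prod_univ_three, Fin.prod_univ_three]
  have h := fun i k => coeffNorm_pow_le (hu i) k
  have h' := fun i k => (coeffNorm_nonneg _).trans (h i k)
  refine (coeffNorm_mul_le _ _).trans (mul_le_mul ?_ hg (coeffNorm_nonneg _)
    (mul_nonneg (mul_nonneg (h' _ _) (h' _ _)) (h' _ _)))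
  refine (coeffNorm_mul_le _ _).trans (mul_le_mul ?_ (h _ _) (coeffNorm_nonneg _)
    (mul_nonneg (h' _ _) (h' _ _)))
  exact (coeffNorm_mul_le _ _).trans (mul_le_mul (h _ _) (h _ _) (coeffNorm_nonneg _) (h' _ _))

theorem coeffNorm_evalHom_le {a u : Fin 3 → MvPolynomial (Fin 3) ℤ} {a' u' : Fin 3 → ℤ}
    (ha : ∀ i, coeffNorm (a i) ≤ a' i) (hu : ∀ i, coeffNorm (u i) ≤ u' i) (p : PExpr) :
    coeffNorm (evalHom a u p) ≤ majorant a' u' p := by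
  induction p with
  | c n => simpa [evalHom, majorant] using coeffNorm_C_le (σ := Fin 3) n
  | x i => exact ha i
  | add p q hp hq =>
    exact (coeffNorm_add_le _ _).trans
      (add_le_add (coeffNorm_padding_mul_le hu p q hp) (coeffNorm_padding_mul_le hu q p hq))
  | sub p q hp hq =>
    exact (coeffNorm_sub_le _ _).trans
      (add_le_add (coeffNorm_padding_mul_le hu p q hp) (coeffNorm_padding_mul_le hu q p hq))
  | mul p q hp hq =>
    exact (coeffNorm_mul_le _ _).trans (mul_le_mul hp hq (coeffNorm_nonneg _)
      ((coeffNorm_nonneg _).trans hp))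

theorem degreeOf_evalHom_le {a u : Fin 3 → MvPolynomial (Fin 3) ℤ}
    (ha : ∀ i j, degreeOf i (a j) ≤ if j = i then 1 else 0)
    (hu : ∀ i j, degreeOf i (u j) ≤ if j = i then 1 else 0) (i : Fin 3) (p : PExpr) :
    degreeOf i (evalHom a u p) ≤ deg i p := by
  have key : ∀ (p q : PExpr) (g : MvPolynomial (Fin 3) ℤ), degreeOf i g ≤ deg i p →
      degreeOf i (padding u p q * g) ≤ max (deg i p) (deg i q) := by
    intro p q g hg
    have h1 : degreeOf i (padding u p q) ≤ deg i q - deg i p := by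
      refine (degreeOf_prod_le _ _ _).trans ?_
      refine (Finset.sum_le_sum fun j _ => (degreeOf_pow_le _ _ _).trans
        (Nat.mul_le_mul_left _ (hu i j))).trans ?_
      simp
    have := degreeOf_mul_le i (padding u p q) g
    omega
  induction p with
  | c n =>
    rw [evalHom, ← map_intCast (C : ℤ →+* MvPolynomial (Fin 3) ℤ), degreeOf_C]
    exact Nat.zero_le _
  | x j => exact ha i j
  | add p q hp hq =>
    have := degreeOf_add_le i (padding u p q * evalHom a u p) (padding u q p * evalHom a u q)
    have := key p q _ hp
    have := key q p _ hq
    simp only [evalHom, deg] at *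
    omega
  | sub p q hp hq =>
    have := degreeOf_sub_le i (padding u p q * evalHom a u p) (padding u q p * evalHom a u q)
    have := key p q _ hp
    have := key q p _ hq
    simp only [evalHom, deg] at *
    omega
  | mul p q hp hq =>
    exact (degreeOf_mul_le _ _ _).trans (add_le_add hp hq)

end PExpr

/-- The natural number whose `k` lowest digits in base `2 ^ (M + 1)` are all `2 ^ M`. -/
def digitMask (M : ℕ) : ℕ → ℕ
  | 0 => 0
  | k + 1 => 2 ^ M + 2 ^ (M + 1) * digitMask M k

theorem nonneg_of_land_digitMask {M K : ℕ} (a : ℕ → ℤ) (N : ℕ) (ha : ∀ k, |a k| < 2 ^ M)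
    (hN : (N : ℤ) = ∑ k ∈ Finset.range K, a k * (2 ^ (M + 1)) ^ k)
    (hland : Nat.land N (digitMask M K) = 0) : ∀ k < K, 0 ≤ a k := by
  induction K generalizing a N with
  | zero => simp
  | succ K ih =>
    rw [Finset.sum_range_succ', pow_zero, mul_one] at hN
    set N' := ∑ k ∈ Finset.range K, a (k + 1) * (2 ^ (M + 1)) ^ k with hN'
    have hsum : (N : ℤ) = 2 ^ (M + 1) * N' + a 0 := by
      rw [hN, hN', Finset.mul_sum]
      congr 1
      exact Finset.sum_congr rfl fun k _ => by ring
    have hbit : N.testBit M = false := by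
      have h1 : (Nat.land N (digitMask M (K + 1))).testBit M = false := by rw [hland]; simp
      have h2 : (digitMask M (K + 1)).testBit M = true := by
        rw [digitMask, Nat.testBit_eq_decide_div_mod_eq]
        have : 2 ^ M + 2 ^ (M + 1) * digitMask M K = 2 ^ M * (1 + 2 * digitMask M K) := by ring
        rw [this, Nat.mul_div_cancel_left _ (by positivity)]
        simp
      have h3 : (N &&& digitMask M (K + 1)).testBit M = false := h1
      rw [Nat.testBit_and, h2] at h3
      simpa using h3
    have hp : (2 : ℤ) ^ (M + 1) = 2 * 2 ^ M := by ring
    have hpos : (0 : ℤ) < 2 ^ M := by positivity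
    have ha0 : 0 ≤ a 0 := by
      by_contra! hneg
      have h4 := (abs_lt.1 (ha 0)).1
      have h5 : (N : ℤ) / 2 ^ M = 2 * (N' - 1) + 1 := by
        rw [hsum]
        have : (2 : ℤ) ^ (M + 1) * N' + a 0 = (2 ^ M + a 0) + 2 ^ M * (2 * (N' - 1) + 1) := by
          rw [hp]; ring
        rw [this, Int.add_mul_ediv_left _ _ hpos.ne', Int.ediv_eq_zero_of_lt] <;> linarith
      rw [Nat.testBit_eq_decide_div_mod_eq] at hbit
      have h6 : ((N / 2 ^ M : ℕ) : ℤ) = 2 * (N' - 1) + 1 := by rw [← h5]; push_cast; rfl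
      have h7 : (N / 2 ^ M) % 2 = 1 := by omega
      simp [h7] at hbit
    have hdiv : (N : ℤ) / 2 ^ (M + 1) = N' := by
      have h4 := (abs_lt.1 (ha 0)).2
      rw [hsum, add_comm, Int.add_mul_ediv_left _ _ (by positivity),
        Int.ediv_eq_zero_of_lt ha0 (by rw [hp]; linarith), zero_add]
    have hrec := ih (fun k => a (k + 1)) (N / 2 ^ (M + 1)) (fun k => ha _)
      (by rw [← hN', ← hdiv]; push_cast; rfl) (by
        have h8 : (N &&& digitMask M (K + 1)) / 2 ^ (M + 1) = 0 := by
          change Nat.land N _ / _ = 0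
          rw [hland, Nat.zero_div]
        rw [Nat.and_div_two_pow] at h8
        have h9 : digitMask M (K + 1) / 2 ^ (M + 1) = digitMask M K := by
          rw [digitMask, Nat.add_mul_div_left _ _ (by positivity), Nat.div_eq_of_lt, zero_add]
          rw [pow_succ]; have : 0 < 2 ^ M := by positivity
          omega
        rwa [h9] at h8)
    rintro (_ | k) hk
    · exact ha0
    · exact hrec k (by omega)

namespace PExpr
open MvPolynomial

/-- The point at which polynomials of degree at most `d` are evaluated to read off their
coefficients. -/
def kroneckerPoint (M : ℕ) (d : Fin 3 → ℕ) : Fin 3 → ℕ :=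
  ![((2 ^ (M + 1)) ^ (d 2 + 1)) ^ (d 1 + 1), (2 ^ (M + 1)) ^ (d 2 + 1), 2 ^ (M + 1)]

theorem coeff_nonneg_of_land {P : MvPolynomial (Fin 3) ℤ} {d : Fin 3 → ℕ} {M N : ℕ}
    (hd : ∀ i, degreeOf i P ≤ d i) (hM : coeffNorm P < 2 ^ M)
    (hN : MvPolynomial.eval (fun i => (kroneckerPoint M d i : ℤ)) P = N)
    (hland : Nat.land N (digitMask M ((d 0 + 1) * (d 1 + 1) * (d 2 + 1))) = 0)
    (m : Fin 3 →₀ ℕ) : 0 ≤ P.coeff m := by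
  classical
  set κ : (Fin 3 →₀ ℕ) → ℕ := fun m => ((d 1 + 1) * m 0 + m 1) * (d 2 + 1) + m 2 with hκ
  have hle : ∀ m ∈ P.support, ∀ i, m i ≤ d i := fun m hm i =>
    (monomial_le_degreeOf i hm).trans (hd i)
  have hlt : ∀ m ∈ P.support, κ m < (d 0 + 1) * (d 1 + 1) * (d 2 + 1) := by
    intro m hm
    have h0 := hle m hm 0
    have h1 := hle m hm 1
    have h2 := hle m hm 2
    have h3 : (d 1 + 1) * m 0 + m 1 + 1 ≤ (d 0 + 1) * (d 1 + 1) := by nlinarith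
    have h4 := Nat.mul_le_mul_right (d 2 + 1) h3
    simp only [hκ]
    nlinarith
  have hinj : ∀ m ∈ P.support, ∀ n ∈ P.support, κ m = κ n → m = n := by
    intro m hm n hn h
    have hdm : ∀ x y c e f : ℕ, e ≤ c → f ≤ c → x * (c + 1) + e = y * (c + 1) + f →
        x = y ∧ e = f := by
      intro x y c e f he hf h
      have h1 := congrArg (· / (c + 1)) h
      have h2 := congrArg (· % (c + 1)) h
      simp only [Nat.mul_add_mod_of_lt (Nat.lt_succ_of_le he), Nat.mul_add_mod',
        Nat.mod_eq_of_lt (Nat.lt_succ_of_le hf)] at h2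
      rw [h2] at h
      exact ⟨Nat.eq_of_mul_eq_mul_right (Nat.succ_pos c) (Nat.add_right_cancel h), h2⟩
    obtain ⟨h1, h2⟩ := hdm _ _ _ _ _ (hle m hm 2) (hle n hn 2) h
    rw [mul_comm, mul_comm _ (n 0)] at h1
    obtain ⟨h3, h4⟩ := hdm _ _ _ _ _ (hle m hm 1) (hle n hn 1) h1
    ext i
    fin_cases i <;> assumption
  set a : ℕ → ℤ := fun k => ∑ m ∈ P.support with κ m = k, P.coeff m with haa
  have hab : ∀ k, |a k| < 2 ^ M := fun k =>
    ((Finset.abs_sum_le_sum_abs _ _).trans (Finset.sum_le_sum_of_subset_of_nonneg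
      (Finset.filter_subset _ _) fun _ _ _ => abs_nonneg _)).trans_lt hM
  have hsum : (N : ℤ) =
      ∑ k ∈ Finset.range ((d 0 + 1) * (d 1 + 1) * (d 2 + 1)), a k * (2 ^ (M + 1)) ^ k := by
    rw [← hN, eval_eq', ← Finset.sum_fiberwise_of_maps_to (g := κ)
      (fun m hm => Finset.mem_range.2 (hlt m hm))]
    refine Finset.sum_congr rfl fun k _ => ?_
    rw [haa, Finset.sum_mul]
    refine Finset.sum_congr rfl fun m hm => ?_
    rw [← (Finset.mem_filter.1 hm).2, hκ, Fin.prod_univ_three]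
    have h0 : kroneckerPoint M d 0 = ((2 ^ (M + 1)) ^ (d 2 + 1)) ^ (d 1 + 1) := rfl
    have h1 : kroneckerPoint M d 1 = (2 ^ (M + 1)) ^ (d 2 + 1) := rfl
    have h2 : kroneckerPoint M d 2 = 2 ^ (M + 1) := rfl
    rw [h0, h1, h2]
    push_cast
    generalize (2 : ℤ) ^ (M + 1) = B
    ring
  by_cases hm : m ∈ P.support
  · have h := nonneg_of_land_digitMask a N hab hsum hland _ (hlt m hm)
    have : a (κ m) = P.coeff m := by
      rw [haa]
      have : ({n ∈ P.support | κ n = κ m} : Finset _) = {m} := by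
        ext n
        simp only [Finset.mem_filter, Finset.mem_singleton]
        exact ⟨fun h => hinj _ h.1 _ hm h.2, by rintro rfl; exact ⟨hm, rfl⟩⟩
      simp only [this, Finset.sum_singleton]
    rwa [this] at h
  · rw [notMem_support_iff.1 hm]

/-- Test whether all Bernstein coefficients of `p` on the box `lo ≤ D * v ≤ hi` are nonnegative,
given a point `Z` and a mask suited to `p`. -/
def bernsteinTest (Z : Fin 3 → ℤ) (D : ℤ) (mask : ℕ) (p : PExpr) (lo hi : Fin 3 → ℤ) : Bool :=
  match evalInt (fun i => Int.add (lo i) (Int.mul (hi i) (Z i)))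
    (fun i => Int.mul D (Int.add 1 (Z i))) p with
  | .ofNat n => Nat.beq (Nat.land n mask) 0
  | .negSucc _ => false

/-- Apply `bernsteinTest`, bisecting the box along the listed variables where necessary. -/
def bernsteinCheck (Z : Fin 3 → ℤ) (D : ℤ) (mask : ℕ) (p : PExpr) :
    List (Fin 3) → (Fin 3 → ℤ) → (Fin 3 → ℤ) → Bool
  | [], lo, hi => bernsteinTest Z D mask p lo hi
  | i :: o, lo, hi => bernsteinTest Z D mask p lo hi ||
    (bernsteinCheck Z D mask p o lo (Function.update hi i ((lo i + hi i) / 2)) &&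
      bernsteinCheck Z D mask p o (Function.update lo i ((lo i + hi i) / 2)) hi)

/-- A certificate for the nonnegativity of `p` on the box `lo ≤ D * v ≤ hi`. -/
def certify (M : ℕ) (D : ℤ) (p : PExpr) (o : List (Fin 3)) (lo hi : Fin 3 → ℤ) : Bool :=
  decide (majorant (fun i => 2 * max |lo i| |hi i|) (fun _ => 2 * |D|) p < 2 ^ M) &&
    bernsteinCheck (fun i => (kroneckerPoint M (fun i => deg i p) i : ℤ)) D
      (digitMask M ((deg 0 p + 1) * (deg 1 p + 1) * (deg 2 p + 1))) p o lo hi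

theorem eval_nonneg_of_bernsteinTest {M : ℕ} {D : ℤ} (hD : 0 < D) {p : PExpr} {w : Fin 3 → ℤ}
    (hw : majorant (fun i => 2 * w i) (fun _ => 2 * |D|) p < 2 ^ M) {lo hi : Fin 3 → ℤ}
    (hlo : ∀ i, |lo i| ≤ w i) (hhi : ∀ i, |hi i| ≤ w i)
    (h : bernsteinTest (fun i => (kroneckerPoint M (fun i => deg i p) i : ℤ)) D
      (digitMask M ((deg 0 p + 1) * (deg 1 p + 1) * (deg 2 p + 1))) p lo hi = true)
    {v : Fin 3 → ℝ} (hv : ∀ i, lo i ≤ D * v i ∧ D * v i < hi i) : 0 ≤ eval v p := by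
  set a : Fin 3 → MvPolynomial (Fin 3) ℤ := fun i => C (lo i) + C (hi i) * X i with ha
  set u : Fin 3 → MvPolynomial (Fin 3) ℤ := fun i => C D * (C 1 + X i) with hu
  have hna : ∀ i, coeffNorm (a i) ≤ 2 * w i := fun i => by
    have h1 := coeffNorm_add_le (C (lo i)) (C (hi i) * X i : MvPolynomial (Fin 3) ℤ)
    have h2 := coeffNorm_mul_le (C (hi i)) (X i : MvPolynomial (Fin 3) ℤ)
    have h3 := mul_le_mul (coeffNorm_C_le (σ := Fin 3) (hi i)) (coeffNorm_X_le i)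
      (coeffNorm_nonneg _) (abs_nonneg _)
    have h4 := coeffNorm_C_le (σ := Fin 3) (lo i)
    linarith [hlo i, hhi i]
  have hnu : ∀ i, coeffNorm (u i) ≤ 2 * |D| := fun i => by
    have h1 := coeffNorm_mul_le (C D) (C 1 + X i : MvPolynomial (Fin 3) ℤ)
    have h2 := coeffNorm_add_le (C 1) (X i : MvPolynomial (Fin 3) ℤ)
    have h3 := coeffNorm_C_le (σ := Fin 3) 1
    have h4 := coeffNorm_X_le i
    have h5 := coeffNorm_C_le (σ := Fin 3) D
    have h6 := mul_le_mul h5 (h2.trans (add_le_add h3 h4)) (coeffNorm_nonneg _) (abs_nonneg _)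
    simp only [abs_one] at h6
    linarith
  have hX : ∀ i j : Fin 3, degreeOf i (X j : MvPolynomial (Fin 3) ℤ) ≤ if j = i then 1 else 0 :=
    fun i j => by rw [degreeOf_X]; split_ifs <;> simp_all
  have hC : ∀ (i : Fin 3) (n : ℤ), degreeOf i (C n : MvPolynomial (Fin 3) ℤ) = 0 :=
    fun i n => degreeOf_C n i
  have hda : ∀ i j, degreeOf i (a j) ≤ if j = i then 1 else 0 := fun i j => by
    have h1 := degreeOf_add_le i (C (lo j)) (C (hi j) * X j : MvPolynomial (Fin 3) ℤ)
    have h2 := degreeOf_mul_le i (C (hi j)) (X j : MvPolynomial (Fin 3) ℤ)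
    rw [hC] at h1 h2
    exact h1.trans (max_le (Nat.zero_le _) (h2.trans (by simpa using hX i j)))
  have hdu : ∀ i j, degreeOf i (u j) ≤ if j = i then 1 else 0 := fun i j => by
    have h1 := degreeOf_add_le i (C 1) (X j : MvPolynomial (Fin 3) ℤ)
    have h2 := degreeOf_mul_le i (C D) (C 1 + X j : MvPolynomial (Fin 3) ℤ)
    rw [hC] at h1 h2
    refine h2.trans ?_
    rw [zero_add]
    exact h1.trans (max_le (Nat.zero_le _) (hX i j))
  have hcoeff : ∀ m, 0 ≤ (evalHom a u p).coeff m := by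
    rw [bernsteinTest] at h
    split at h
    · next n hn =>
      refine coeff_nonneg_of_land (N := n) (degreeOf_evalHom_le hda hdu · p)
        ((coeffNorm_evalHom_le hna hnu p).trans_lt hw) ?_ (Nat.eq_of_beq_eq_true h)
      rw [map_evalHom, ← Int.ofNat_eq_natCast, ← hn, evalInt_eq]
      congr 1
      · funext i; simp [ha]
      · funext i; simp [hu]
    · exact absurd h (by simp)
  set t : Fin 3 → ℝ := fun i => (D * v i - lo i) / (hi i - D * v i) with ht
  have hD' : (0 : ℝ) < D := by exact_mod_cast hD
  have ht0 : ∀ i, 0 ≤ t i := fun i =>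
    div_nonneg (sub_nonneg.2 (hv i).1) (sub_nonneg.2 (hv i).2.le)
  have hnonneg : 0 ≤ eval₂Hom (Int.castRingHom ℝ) t (evalHom a u p) := by
    rw [coe_eval₂Hom, eval₂_eq]
    exact Finset.sum_nonneg fun m _ => mul_nonneg (by simpa using hcoeff m)
      (Finset.prod_nonneg fun i _ => pow_nonneg (ht0 i) _)
  have hta : ∀ i, eval₂Hom (Int.castRingHom ℝ) t (a i) = lo i + hi i * t i := fun i => by
    simp only [ha, map_add, map_mul, eval₂Hom_X', eq_intCast, map_intCast]
  have htu : ∀ i, eval₂Hom (Int.castRingHom ℝ) t (u i) = D * (1 + t i) := fun i => by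
    simp only [hu, map_add, map_mul, eval₂Hom_X', eq_intCast, map_intCast, map_one]
  rw [map_evalHom] at hnonneg
  have : (fun i => eval₂Hom (Int.castRingHom ℝ) t (a i)) =
      fun i => eval₂Hom (Int.castRingHom ℝ) t (u i) * v i := by
    funext i
    have := sub_pos.2 (hv i).2
    rw [hta, htu]
    simp only [ht]
    field_simp
    ring
  rw [this, evalHom_eq] at hnonneg
  refine nonneg_of_mul_nonneg_right hnonneg (Finset.prod_pos fun i _ => pow_pos ?_ _)
  have := ht0 i
  rw [htu]
  positivity

theorem eval_nonneg_of_bernsteinCheck {M : ℕ} {D : ℤ} (hD : 0 < D) {p : PExpr} {w : Fin 3 → ℤ}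
    (hw : majorant (fun i => 2 * w i) (fun _ => 2 * |D|) p < 2 ^ M) {o : List (Fin 3)}
    {lo hi : Fin 3 → ℤ} (hlo : ∀ i, |lo i| ≤ w i) (hhi : ∀ i, |hi i| ≤ w i)
    (h : bernsteinCheck (fun i => (kroneckerPoint M (fun i => deg i p) i : ℤ)) D
      (digitMask M ((deg 0 p + 1) * (deg 1 p + 1) * (deg 2 p + 1))) p o lo hi = true)
    {v : Fin 3 → ℝ} (hv : ∀ i, lo i ≤ D * v i ∧ D * v i < hi i) : 0 ≤ eval v p := by
  induction o generalizing lo hi with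
  | nil => exact eval_nonneg_of_bernsteinTest hD hw hlo hhi h hv
  | cons i o ih =>
    have hmid : |(lo i + hi i) / 2| ≤ w i := by
      have h1 := abs_le.1 (hlo i)
      have h2 := abs_le.1 (hhi i)
      rw [abs_le]
      constructor <;> omega
    rw [bernsteinCheck, Bool.or_eq_true, Bool.and_eq_true] at h
    rcases h with h | ⟨h1, h2⟩
    · exact eval_nonneg_of_bernsteinTest hD hw hlo hhi h hv
    · rcases lt_or_ge (D * v i) (((lo i + hi i) / 2 : ℤ) : ℝ) with hc | hc
      · refine ih hlo (fun j => ?_) h1 fun j => ?_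
        · rcases eq_or_ne j i with rfl | hj
          · simpa using hmid
          · simpa [hj] using hhi j
        · rcases eq_or_ne j i with rfl | hj
          · exact ⟨(hv j).1, by simpa using hc⟩
          · simpa [hj] using hv j
      · refine ih (fun j => ?_) hhi h2 fun j => ?_
        · rcases eq_or_ne j i with rfl | hj
          · simpa using hmid
          · simpa [hj] using hlo j
        · rcases eq_or_ne j i with rfl | hj
          · exact ⟨by simpa using hc, (hv j).2⟩
          · simpa [hj] using hv j

theorem continuous_eval (p : PExpr) : Continuous fun v : Fin 3 → ℝ => eval v p := by
  induction p with
  | c n => exact continuous_const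
  | x i => exact continuous_apply i
  | add p q hp hq => exact hp.add hq
  | sub p q hp hq => exact hp.sub hq
  | mul p q hp hq => exact hp.mul hq

theorem eval_nonneg_of_certify {M : ℕ} {D : ℤ} (hD : 0 < D) {p : PExpr} {o : List (Fin 3)}
    {lo hi : Fin 3 → ℤ} (h : certify M D p o lo hi = true) (hlt : ∀ i, lo i < hi i)
    {v : Fin 3 → ℝ} (hv : ∀ i, lo i ≤ D * v i ∧ D * v i ≤ hi i) : 0 ≤ eval v p := by
  rw [certify, Bool.and_eq_true, decide_eq_true_iff] at h
  have hD' : (0 : ℝ) < D := by exact_mod_cast hD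
  have hopen : ∀ s ∈ Set.Ioo (0 : ℝ) 1, 0 ≤ eval (fun i => lo i / D + s * (v i - lo i / D)) p := by
    rintro s ⟨hs0, hs1⟩
    refine eval_nonneg_of_bernsteinCheck hD h.1 (fun i => le_max_left _ _)
      (fun i => le_max_right _ _) h.2 fun i => ?_
    have h1 : D * (lo i / D + s * (v i - lo i / D)) = lo i + s * (D * v i - lo i) := by
      field_simp
    have h2 : (lo i : ℝ) < hi i := by exact_mod_cast hlt i
    obtain ⟨h3, h4⟩ := hv i
    rw [h1]
    constructor <;> nlinarith
  have hcont : Continuous fun s : ℝ => eval (fun i => lo i / D + s * (v i - lo i / D)) p :=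
    (continuous_eval p).comp (by fun_prop)
  have hlim := (hcont.tendsto 1).mono_left (nhdsWithin_le_nhds (s := Set.Iio 1))
  have := ge_of_tendsto hlim (Filter.eventually_of_mem (Ioo_mem_nhdsLT one_pos) hopen)
  simpa using this

end PExpr

/-- The area of the part of the unit disk above the horizontal line at height `b`. -/
noncomputable def capArea (b : ℝ) : ℝ := arccos b - b * √(1 - b ^ 2)

theorem capArea_one : capArea 1 = 0 := by simp [capArea]

theorem capArea_zero : capArea 0 = π / 2 := by simp [capArea]

theorem continuous_capArea : Continuous capArea := by
  unfold capArea
  exact continuous_arccos.sub (by fun_prop)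

theorem hasDerivAt_capArea {b : ℝ} (h₁ : -1 < b) (h₂ : b < 1) :
    HasDerivAt capArea (-2 * √(1 - b ^ 2)) b := by
  have hpos : 0 < 1 - b ^ 2 := by nlinarith
  have h3 : HasDerivAt (fun x : ℝ => 1 - x ^ 2) (-(2 * b)) b := by
    simpa using (hasDerivAt_pow 2 b).const_sub 1
  have h := (hasDerivAt_arccos h₁.ne' h₂.ne).sub ((hasDerivAt_id b).mul (h3.sqrt hpos.ne'))
  refine h.congr_deriv ?_
  have hs : 0 < √(1 - b ^ 2) := sqrt_pos.2 hpos
  have hq : √(1 - b ^ 2) ^ 2 = 1 - b ^ 2 := sq_sqrt hpos.le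
  simp only [id]
  field_simp
  rw [hq]
  ring

theorem sqrt_add_sqrt_le {m s : ℝ} (hs : 0 ≤ s) (h₁ : -1 ≤ m - s) (h₂ : m + s ≤ 1) :
    √(1 - (m - s) ^ 2) + √(1 - (m + s) ^ 2) ≤ 2 * √(1 - m ^ 2) - s ^ 2 := by
  have h3 : 0 ≤ 1 - (m - s) ^ 2 := by nlinarith
  have h4 : 0 ≤ 1 - (m + s) ^ 2 := by nlinarith
  have h5 : s ^ 2 ≤ 1 - m ^ 2 := by nlinarith
  have hu := sq_sqrt h3
  have hw := sq_sqrt h4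
  have hp := sq_sqrt ((sq_nonneg s).trans h5)
  have hp0 : s ≤ √(1 - m ^ 2) := le_sqrt_of_sq_le h5
  have hp1 : √(1 - m ^ 2) ≤ 1 := sqrt_le_one.2 (by nlinarith [sq_nonneg m])
  set u := √(1 - (m - s) ^ 2)
  set w := √(1 - (m + s) ^ 2)
  set p := √(1 - m ^ 2)
  have h6 : 0 ≤ 2 * p - s ^ 2 := by nlinarith
  refine le_of_sq_le_sq ?_ h6
  nlinarith [sq_nonneg (u - w), mul_nonneg (sq_nonneg s) (sub_nonneg.2 hp1), sq_nonneg (s ^ 2)]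

/-- Midpoint bound for the area of a slice of the unit disk. -/
theorem capArea_sub_capArea_le {b k : ℝ} (hk : 0 ≤ k) (h₁ : -1 ≤ b) (h₂ : b + k ≤ 1) :
    capArea b - capArea (b + k) ≤ 2 * k * √(1 - (b + k / 2) ^ 2) - k ^ 3 / 12 := by
  set m := b + k / 2 with hm
  let Φ : ℝ → ℝ := fun s =>
    capArea (m - s) - capArea (m + s) - 4 * √(1 - m ^ 2) * s + 2 / 3 * s ^ 3
  have hcont : Continuous Φ := by
    have := continuous_capArea
    fun_prop
  have hderiv : ∀ s ∈ interior (Set.Icc 0 (k / 2)), HasDerivAt Φ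
      (-(-2 * √(1 - (m - s) ^ 2)) - (-2 * √(1 - (m + s) ^ 2)) - 4 * √(1 - m ^ 2)
        + 2 / 3 * (3 * s ^ 2)) s := by
    intro s hs
    rw [interior_Icc] at hs
    have h3 : HasDerivAt (fun s => capArea (m - s)) (-(-2 * √(1 - (m - s) ^ 2))) s :=
      (hasDerivAt_capArea (by linarith [hs.1, hs.2])
        (by linarith [hs.1, hs.2])).comp_const_sub m s
    have h4 : HasDerivAt (fun s => capArea (m + s)) (-2 * √(1 - (m + s) ^ 2)) s :=
      (hasDerivAt_capArea (by linarith [hs.1, hs.2])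
        (by linarith [hs.1, hs.2])).comp_const_add m s
    have h5 := ((h3.sub h4).sub ((hasDerivAt_id s).const_mul (4 * √(1 - m ^ 2)))).add
      ((hasDerivAt_pow 3 s).const_mul (2 / 3 : ℝ))
    refine h5.congr_deriv ?_
    norm_num
  have hanti : AntitoneOn Φ (Set.Icc 0 (k / 2)) :=
    antitoneOn_of_deriv_nonpos (convex_Icc _ _) hcont.continuousOn
      (fun s hs => (hderiv s hs).differentiableAt.differentiableWithinAt) fun s hs => by
        rw [(hderiv s hs).deriv]
        rw [interior_Icc] at hs
        have := sqrt_add_sqrt_le (m := m) hs.1.le (by linarith [hs.2]) (by linarith [hs.2])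
        linarith
  have h := hanti (Set.left_mem_Icc.2 (by linarith)) (Set.right_mem_Icc.2 (by linarith))
    (by linarith : (0 : ℝ) ≤ k / 2)
  simp only [Φ, sub_zero, add_zero] at h
  have e1 : m - k / 2 = b := by rw [hm]; ring
  have e2 : m + k / 2 = b + k := by rw [hm]; ring
  rw [e1, e2] at h
  ring_nf at h ⊢
  linarith

/-- A polynomial lower bound for `capArea`. -/
theorem le_capArea {b : ℝ} (h₁ : -0.35 ≤ b) (h₂ : b ≤ 1) :
    1.5705 - 2 * b + b ^ 3 / 3 + b ^ 5 / 20 ≤ capArea b := by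
  have hpi := pi_gt_d4
  have hpoly : ∀ (c x : ℝ), HasDerivAt
      (fun b : ℝ => capArea 0 - 2 * b + b ^ 3 / 3 + b ^ 5 / 20 + c * b ^ 7)
      (-2 + x ^ 2 + x ^ 4 / 4 + c * (7 * x ^ 6)) x := by
    intro c x
    have h := ((((hasDerivAt_id x).const_mul (2 : ℝ)).const_sub (capArea 0)).add
      ((hasDerivAt_pow 3 x).div_const 3)).add ((hasDerivAt_pow 5 x).div_const 20) |>.add
      ((hasDerivAt_pow 7 x).const_mul c)
    refine h.congr_deriv ?_
    norm_num
    ring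
  rcases le_total 0 b with hb | hb
  · let f : ℝ → ℝ := fun b =>
      capArea b - (capArea 0 - 2 * b + b ^ 3 / 3 + b ^ 5 / 20 + 0 * b ^ 7)
    have hd : ∀ x ∈ interior (Set.Icc (0 : ℝ) 1), HasDerivAt f
        (-2 * √(1 - x ^ 2) - (-2 + x ^ 2 + x ^ 4 / 4 + 0 * (7 * x ^ 6))) x := fun x hx => by
      rw [interior_Icc] at hx
      exact (hasDerivAt_capArea (by linarith [hx.1]) hx.2).sub (hpoly 0 x)
    have hmono : MonotoneOn f (Set.Icc 0 1) :=
      monotoneOn_of_deriv_nonneg (convex_Icc _ _) (by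
          have := continuous_capArea
          fun_prop)
        (fun x hx => (hd x hx).differentiableAt.differentiableWithinAt) fun x hx => by
          rw [(hd x hx).deriv]
          rw [interior_Icc] at hx
          obtain ⟨hx0, hx1⟩ := hx
          have h3 : x ^ 2 ≤ 1 := by nlinarith
          have h4 : √(1 - x ^ 2) ≤ 1 - x ^ 2 / 2 - x ^ 4 / 8 := by
            refine sqrt_le_iff.2 ⟨by nlinarith [sq_nonneg x], ?_⟩
            have : 0 ≤ x ^ 6 / 8 + x ^ 8 / 64 := by positivity
            linarith
          linarith
    have h := hmono ⟨le_rfl, zero_le_one⟩ ⟨hb, h₂⟩ hb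
    simp only [f] at h
    rw [capArea_zero] at h
    norm_num at h
    linarith
  · let f : ℝ → ℝ := fun b =>
      capArea b - (capArea 0 - 2 * b + b ^ 3 / 3 + b ^ 5 / 20 + 1 / 7 * b ^ 7)
    have hd : ∀ x ∈ interior (Set.Icc (-0.35 : ℝ) 0), HasDerivAt f
        (-2 * √(1 - x ^ 2) - (-2 + x ^ 2 + x ^ 4 / 4 + 1 / 7 * (7 * x ^ 6))) x := fun x hx => by
      rw [interior_Icc] at hx
      exact (hasDerivAt_capArea (by linarith [hx.1]) (by linarith [hx.2])).sub (hpoly (1 / 7) x)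
    have hanti : AntitoneOn f (Set.Icc (-0.35) 0) :=
      antitoneOn_of_deriv_nonpos (convex_Icc _ _) (by
          have := continuous_capArea
          fun_prop)
        (fun x hx => (hd x hx).differentiableAt.differentiableWithinAt) fun x hx => by
          rw [(hd x hx).deriv]
          rw [interior_Icc] at hx
          obtain ⟨hx0, hx1⟩ := hx
          have h3 : x ^ 2 ≤ 1 / 8 := by nlinarith
          have h4 : 1 - x ^ 2 / 2 - x ^ 4 / 8 - x ^ 6 / 2 ≤ √(1 - x ^ 2) := by
            refine le_sqrt_of_sq_le ?_
            have h0 := sq_nonneg x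
            generalize hy : x ^ 2 = y at *
            have e4 : x ^ 4 = y ^ 2 := by rw [← hy]; ring
            have e6 : x ^ 6 = y ^ 3 := by rw [← hy]; ring
            rw [e4, e6]
            have h5 : 0 ≤ y ^ 3 := by positivity
            have h6 : y ^ 3 * (-7 / 8 + 33 / 64 * y + y ^ 2 / 8 + y ^ 3 / 4) ≤ 0 :=
              mul_nonpos_of_nonneg_of_nonpos h5 (by nlinarith [pow_le_pow_left₀ h0 h3 3])
            nlinarith
          linarith
    have h := hanti ⟨h₁, hb⟩ ⟨by norm_num, le_rfl⟩ hb
    simp only [f] at h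
    rw [capArea_zero] at h
    norm_num at h
    have h7 : -(35 / 100 : ℝ) ^ 7 ≤ b ^ 7 := by
      have := pow_le_pow_left₀ (by linarith : 0 ≤ -b) (by linarith : -b ≤ 35 / 100) 7
      rw [Odd.neg_pow (by decide)] at this
      linarith
    norm_num at h7
    linarith

namespace PExpr

theorem eval_add {R : Type*} [CommRing R] (v : Fin 3 → R) (p q : PExpr) :
    eval v (p + q) = eval v p + eval v q := rfl

theorem eval_sub {R : Type*} [CommRing R] (v : Fin 3 → R) (p q : PExpr) :
    eval v (p - q) = eval v p - eval v q := rfl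

theorem eval_mul {R : Type*} [CommRing R] (v : Fin 3 → R) (p q : PExpr) :
    eval v (p * q) = eval v p * eval v q := rfl

theorem eval_c {R : Type*} [CommRing R] (v : Fin 3 → R) (n : ℤ) : eval v (c n) = n := rfl

theorem eval_x {R : Type*} [CommRing R] (v : Fin 3 → R) (i : Fin 3) : eval v (x i) = v i := rfl

theorem eval_nonneg_of_certify₃ {M : ℕ} {D : ℤ} {p : PExpr} {o : List (Fin 3)}
    {l₀ l₁ l₂ h₀ h₁ h₂ : ℤ} (h : certify M D p o ![l₀, l₁, l₂] ![h₀, h₁, h₂] = true)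
    (hlt : 0 < D ∧ l₀ < h₀ ∧ l₁ < h₁ ∧ l₂ < h₂) {a b c : ℝ}
    (ha : l₀ ≤ D * a ∧ D * a ≤ h₀) (hb : l₁ ≤ D * b ∧ D * b ≤ h₁) (hc : l₂ ≤ D * c ∧ D * c ≤ h₂) :
    0 ≤ eval ![a, b, c] p := by
  refine eval_nonneg_of_certify hlt.1 h (fun i => ?_) fun i => ?_
  · fin_cases i
    exacts [hlt.2.1, hlt.2.2.1, hlt.2.2.2]
  · fin_cases i
    exacts [ha, hb, hc]

end PExpr

/-- A lower bound for the total squared diameters that a greedy row packing accommodates above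
the height `b`, when the last row had height `h`. -/
noncomputable def potential (b h : ℝ) : ℝ :=
  capArea b - 0.57 * h * (1 - b) ^ 3 - 0.16 * (1 - b) * h ^ 2

theorem potential_one (h : ℝ) : potential 1 h = 0 := by simp [potential, capArea_one]

/-- The gain, relative to `h ^ 2`, of the correction terms in `potential` when a row of height
`h` is followed by a row of height `h * x`. -/
noncomputable def correctionGain (b h x : ℝ) : ℝ :=
  (0.57 * (1 - b) ^ 3 - x * (0.57 * (1 - b - h * x) ^ 3)) / h
    + 0.16 * (1 - b - (1 - b - h * x) * x ^ 2) + h * x ^ 3 / 12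

theorem sub_mul_le_of_sq_eq {P u p q l : ℝ} (hP : P ^ 2 = p) (hu : u ^ 2 = q) :
    (P - u) * (2 * l * u) ≤ p - q + (l - 1) ^ 2 * q := by
  have h1 := sq_nonneg (P - l * u)
  rw [← hP, ← hu]
  linarith

theorem potential_le_of_correctionGain {b h x ε : ℝ} (hh : 0 < h) (hx : 0 ≤ x) (hε : 0 ≤ ε)
    (hb : -1 ≤ b) (hbx : b + h * x ≤ 1) (hq : 0 < (1 + b - h) * (1 - b))
    (H : x * (1 - b - b * x - h * x ^ 2 / 4 + h * ε ^ 2 * ((1 + b - h) * (1 - b))) ≤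
      correctionGain b h x * (1 + h * ε) * √((1 + b - h) * (1 - b))) :
    potential b h ≤ 2 * (h * x) * √((1 + b - h) * (1 - b)) + potential (b + h * x) (h * x) := by
  have hk : 0 ≤ h * x := mul_nonneg hh.le hx
  have hA := capArea_sub_capArea_le hk hb hbx
  have hp0 : 0 ≤ 1 - (b + h * x / 2) ^ 2 := by
    have h1 := mul_nonneg (by linarith : 0 ≤ 1 - (b + h * x / 2))
      (by linarith : 0 ≤ 1 + (b + h * x / 2))
    linarith
  have hpq : 1 - (b + h * x / 2) ^ 2 - (1 + b - h) * (1 - b) =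
      h * (1 - b - b * x - h * x ^ 2 / 4) := by ring
  have h3 := sub_mul_le_of_sq_eq (l := 1 + h * ε) (sq_sqrt hp0) (sq_sqrt hq.le)
  rw [hpq] at h3
  have hu : 0 < √((1 + b - h) * (1 - b)) := sqrt_pos.2 hq
  generalize √(1 - (b + h * x / 2) ^ 2) = P at *
  generalize √((1 + b - h) * (1 - b)) = u at *
  generalize (1 + b - h) * (1 - b) = q at *
  have hl : 0 < 1 + h * ε := by positivity
  have h4 : 2 * x * (P - u) ≤ h * correctionGain b h x := by
    have h5 : 2 * x * (P - u) * ((1 + h * ε) * u) ≤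
        h * correctionGain b h x * ((1 + h * ε) * u) := by
      have h6 := mul_le_mul_of_nonneg_left h3 hx
      have h7 := mul_le_mul_of_nonneg_left H hh.le
      linear_combination h6 + h7
    exact le_of_mul_le_mul_right h5 (by positivity)
  have h8 := mul_le_mul_of_nonneg_left h4 hh.le
  have h9 : h * (h * correctionGain b h x) =
      h * (0.57 * (1 - b) ^ 3) - h * x * (0.57 * (1 - b - h * x) ^ 3)
        + 0.16 * ((1 - b) * h ^ 2 - (1 - b - h * x) * (h * x) ^ 2) + (h * x) ^ 3 / 12 := by
    rw [correctionGain]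
    field_simp
  rw [h9] at h8
  rw [potential, potential]
  linear_combination hA + h8

theorem quartic_le_sqrt {q : ℝ} {U V : ℝ} (hU : 0 ≤ U) (hV : 0 ≤ V) (h : V ^ 2 ≤ 400 * q) :
    U ^ 2 * (V * (2 * U + V)) + 400 * (V * (2 * U + V) + 3 * U ^ 2) * q - 160000 * q ^ 2 ≤
      40 * U * (V * (2 * U + V) + U ^ 2) * √q := by
  have hq : 0 ≤ q := by nlinarith [sq_nonneg V]
  have h2 : √q ^ 2 = q := sq_sqrt hq
  have h3 : V ≤ 20 * √q := by
    have := abs_le_of_sq_le_sq (a := V) (b := 20 * √q) (by rw [mul_pow, h2]; linarith)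
      (by positivity)
    exact (le_abs_self V).trans this
  have h4 : 0 ≤ (20 * √q - U) ^ 2 * (20 * √q - V) * (20 * √q + 2 * U + V) :=
    mul_nonneg (mul_nonneg (sq_nonneg _) (sub_nonneg.2 h3)) (by positivity)
  have h5 : (20 * √q - U) ^ 2 * (20 * √q - V) * (20 * √q + 2 * U + V) =
      40 * U * (V * (2 * U + V) + U ^ 2) * √q - (U ^ 2 * (V * (2 * U + V)) +
        400 * (V * (2 * U + V) + 3 * U ^ 2) * √q ^ 2 - 160000 * (√q ^ 2) ^ 2) := by ring
  rw [h2] at h5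
  linarith

section
open PExpr

/-- The quartic of `quartic_le_sqrt` at `q / 20`, as an expression. -/
def bellmanQuartic (U V : ℤ) (q : PExpr) : PExpr :=
  c (U ^ 2 * (V * (2 * U + V))) + c (20 * (V * (2 * U + V) + 3 * U ^ 2)) * q - c 400 * (q * q)

/-- A polynomial lower bound for `correctionGain`, up to scaling, in `b = x 0`, `x = x 2` and
`H = 20 * h`. -/
def bellmanGain (n d : ℤ) (H : PExpr) : PExpr :=
  let e := c 1 - x 0
  let t := x 2
  c 684 * (c 1 - t) * e * e * e * (c (800 * n * d) - c (20 * n ^ 2) * H) +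
    c (d ^ 2) * (t * t * (c 684 * (c 1200 * e * e - c 60 * e * (H * t) + H * H * t * t) +
      c 5840 * H * t) + c 76800 * e * (c 1 - t * t))

/-- A polynomial in `b = x 0`, `x = x 2` and `H = 20 * h` whose nonnegativity implies the
inequality needed for `potential_le_of_correctionGain`. -/
def bellmanPoly (U V ε n d : ℤ) (H : PExpr) : PExpr :=
  let e := c 1 - x 0
  let t := x 2
  let q := (c 20 * (c 1 + x 0) - H) * e
  bellmanQuartic U V q * bellmanGain n d H * (c 100 + c ε * H) -
    c (40 * U * (V * (2 * U + V) + U ^ 2) * 1200 * d ^ 2) * t *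
      (c 25 * (c 1600 * (e - x 0 * t) - c 20 * H * t * t) + c (4 * ε ^ 2) * H * q)

variable {U V ε n d : ℤ} {H : PExpr} {b h t y : ℝ}

theorem eval_bellmanQuartic {v : Fin 3 → ℝ} {q : PExpr} {q' : ℝ} (hq : eval v q = 20 * q') :
    eval v (bellmanQuartic U V q) = U ^ 2 * (V * (2 * U + V)) +
      400 * (V * (2 * U + V) + 3 * U ^ 2) * q' - 160000 * q' ^ 2 := by
  simp only [bellmanQuartic, eval_add, eval_sub, eval_mul, eval_c, hq]
  push_cast
  ring

theorem eval_bellmanGain (hH : eval ![b, y, t] H = 20 * h) :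
    eval ![b, y, t] (bellmanGain n d H) =
      400 * (684 * (1 - t) * (1 - b) ^ 3 * (2 * n * d - n ^ 2 * h) + d ^ 2 * (t ^ 2 *
        (684 * (3 * (1 - b) ^ 2 - 3 * (1 - b) * (h * t) + (h * t) ^ 2) + 292 * h * t) +
        192 * (1 - b) * (1 - t ^ 2))) := by
  simp only [bellmanGain, eval_add, eval_sub, eval_mul, eval_c, eval_x, hH,
    Matrix.cons_val_zero, Matrix.cons_val]
  push_cast
  generalize 1 - b = e
  ring

theorem eval_bellmanPoly (hH : eval ![b, y, t] H = 20 * h) :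
    eval ![b, y, t] (bellmanPoly U V ε n d H) =
      8000 * ((U ^ 2 * (V * (2 * U + V)) +
        400 * (V * (2 * U + V) + 3 * U ^ 2) * ((1 + b - h) * (1 - b)) -
        160000 * ((1 + b - h) * (1 - b)) ^ 2) *
        (684 * (1 - t) * (1 - b) ^ 3 * (2 * n * d - n ^ 2 * h) + d ^ 2 * (t ^ 2 *
          (684 * (3 * (1 - b) ^ 2 - 3 * (1 - b) * (h * t) + (h * t) ^ 2) + 292 * h * t) +
          192 * (1 - b) * (1 - t ^ 2))) * (5 + ε * h) -
        40 * U * (V * (2 * U + V) + U ^ 2) * (60 * d ^ 2 * t *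
          (25 * (4 * (1 - b - b * t) - h * t ^ 2) + 4 * ε ^ 2 * h * ((1 + b - h) * (1 - b))))) := by
  have hq : eval ![b, y, t] ((c 20 * (c 1 + x 0) - H) * (c 1 - x 0)) =
      20 * ((1 + b - h) * (1 - b)) := by
    simp only [eval_add, eval_sub, eval_mul, eval_c, eval_x, hH, Matrix.cons_val_zero]
    push_cast
    ring
  rw [bellmanPoly, eval_sub, eval_mul, eval_mul, eval_bellmanQuartic hq, eval_bellmanGain hH]
  simp only [eval_add, eval_sub, eval_mul _ (_ * _), eval_mul _ (c _), eval_mul _ (x _), hq, hH, eval_c, eval_x,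
    Matrix.cons_val_zero, Matrix.cons_val]
  push_cast
  generalize 684 * (1 - t) * (1 - b) ^ 3 * _ + (d : ℝ) ^ 2 * _ = g
  generalize (1 + b - h) * (1 - b) = q
  generalize (V : ℝ) * (2 * U + V) = A
  ring

end

theorem le_correctionGain {b h x n d : ℝ} (hh : 0 < h) (hx : x ≤ 1) (hb : b ≤ 1) :
    684 * (1 - x) * (1 - b) ^ 3 * (2 * n * d - n ^ 2 * h) + d ^ 2 * (x ^ 2 *
      (684 * (3 * (1 - b) ^ 2 - 3 * (1 - b) * (h * x) + (h * x) ^ 2) + 292 * h * x) +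
      192 * (1 - b) * (1 - x ^ 2)) ≤ 1200 * d ^ 2 * correctionGain b h x := by
  have h2 : 0 ≤ 684 * (1 - x) * (1 - b) ^ 3 :=
    mul_nonneg (by linarith) (pow_nonneg (by linarith) 3)
  have h3 : (684 * (1 - x) * (1 - b) ^ 3) * (2 * n * d - n ^ 2 * h) ≤
      (684 * (1 - x) * (1 - b) ^ 3) * (d ^ 2 / h) := by
    refine mul_le_mul_of_nonneg_left ?_ h2
    rw [le_div_iff₀ hh]
    linarith [sq_nonneg (d - n * h)]
  have h5 : 1200 * d ^ 2 * correctionGain b h x = 684 * (1 - x) * (1 - b) ^ 3 * (d ^ 2 / h) +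
      d ^ 2 * (x ^ 2 * (684 * (3 * (1 - b) ^ 2 - 3 * (1 - b) * (h * x) + (h * x) ^ 2) +
        292 * h * x) + 192 * (1 - b) * (1 - x ^ 2)) := by
    rw [correctionGain]
    field_simp
    ring
  rw [h5]
  exact add_le_add_left h3 _

theorem le_mul_of_scaled_le {L S u g d C w x T : ℝ} (hS : 0 < S) (hd : 0 < d) (hu : 0 ≤ u)
    (hw : 0 ≤ w) (hL : L ≤ S * u) (hg0 : 0 ≤ g) (hg : g ≤ 1200 * d ^ 2 * C)
    (h : 0 ≤ L * g * w - S * (60 * d ^ 2 * x * T)) : x * (T / 100) ≤ C * (w / 5) * u := by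
  have h1 : L * g * w ≤ S * u * (1200 * d ^ 2 * C) * w :=
    mul_le_mul_of_nonneg_right (mul_le_mul hL hg hg0 (by positivity)) hw
  refine le_of_mul_le_mul_left (a := S * d ^ 2 * 6000) ?_ (by positivity)
  linarith

theorem potential_le_of_bellmanPoly {U V ε n d : ℤ} {H : PExpr} {b h x y : ℝ}
    (hU : 0 < U) (hV : 0 < V) (hε : 0 ≤ ε) (hd : 0 < d) (hn : 0 ≤ n) (hnd : n * h ≤ 2 * d)
    (hh : 0 < h) (hx0 : 0 ≤ x) (hx1 : x ≤ 1) (hb : -1 ≤ b) (hbx : b + h * x ≤ 1)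
    (hq : V ^ 2 ≤ 400 * ((1 + b - h) * (1 - b)))
    (hH : PExpr.eval ![b, y, x] H = 20 * h)
    (hpoly : 0 ≤ PExpr.eval ![b, y, x] (bellmanPoly U V ε n d H)) :
    potential b h ≤ 2 * (h * x) * √((1 + b - h) * (1 - b)) + potential (b + h * x) (h * x) := by
  have hU' : (0 : ℝ) < U := by exact_mod_cast hU
  have hV' : (0 : ℝ) < V := by exact_mod_cast hV
  have hε' : (0 : ℝ) ≤ ε := by exact_mod_cast hε
  have hd' : (0 : ℝ) < d := by exact_mod_cast hd
  have hn' : (0 : ℝ) ≤ n := by exact_mod_cast hn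
  have hhx := mul_nonneg hh.le hx0
  have he : 0 ≤ 1 - b := by linarith
  have hq0 : 0 < (1 + b - h) * (1 - b) := by
    linarith [pow_pos hV' 2]
  refine potential_le_of_correctionGain (ε := ε / 5) hh hx0 (by positivity) hb hbx hq0 ?_
  have hS := quartic_le_sqrt hU'.le hV'.le hq
  rw [eval_bellmanPoly hH] at hpoly
  have key := le_mul_of_scaled_le (by positivity) hd' (sqrt_nonneg _)
    (by positivity : (0 : ℝ) ≤ 5 + ε * h) hS ?_
    (le_correctionGain (b := b) (n := n) hh hx1 (by linarith))
    (nonneg_of_mul_nonneg_right hpoly (by norm_num))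
  · convert key using 2 <;> ring
  · have h1 : 0 ≤ 2 * (n : ℝ) * d - n ^ 2 * h := by
      have := mul_nonneg hn' (sub_nonneg.2 hnd)
      linarith
    have h2 : 0 ≤ 3 * (1 - b) ^ 2 - 3 * (1 - b) * (h * x) + (h * x) ^ 2 := by
      linarith [sq_nonneg (2 * (h * x) - 3 * (1 - b)), sq_nonneg (1 - b)]
    have h3 : 0 ≤ 1 - x ^ 2 := sub_nonneg.2 (pow_le_one₀ hx0 hx1)
    have h4 : 0 ≤ 1 - x := by linarith
    positivity

section
open PExpr

/-- The order in which the coordinates `2` and `0` are bisected. -/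
def bisectionOrder : List (Fin 3) := [2, 0, 2, 0, 2, 0, 2, 0, 2, 0, 2, 0]

set_option maxRecDepth 100000 in
theorem certify_bellman₁ : certify 250 400 (bellmanPoly 17 12 4 2 1 (x 1 * (c 20 * x 0 + c 12)))
    bisectionOrder ![-140, 0, 0] ![-20, 400, 400] = true := by decide +kernel

set_option maxRecDepth 100000 in
theorem certify_bellman₂ : certify 250 400 (bellmanPoly 17 12 4 2 1 (c 20 * x 1))
    bisectionOrder ![-20, 0, 0] ![120, 220, 400] = true := by decide +kernel

set_option maxRecDepth 100000 in
theorem certify_bellman₃ : certify 250 400 (bellmanPoly 15 9 2 2 1 (c 20 * x 1))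
    bisectionOrder ![120, 0, 0] ![320, 220, 400] = true := by decide +kernel

set_option maxRecDepth 100000 in
theorem certify_bellman₄ : certify 250 400
    (bellmanPoly 15 8 2 20 11 (c 11 + x 1 * (c 20 * x 0 - c 6)))
    bisectionOrder ![120, 0, 0] ![204, 400, 400] = true := by decide +kernel

set_option maxRecDepth 100000 in
theorem certify_bellman₅ : certify 250 400 (bellmanPoly 15 8 2 20 11 (c 20 * x 1))
    bisectionOrder ![204, 220, 0] ![320, 304, 400] = true := by decide +kernel

end

/-- The heights and row heights for which the potential satisfies its recursive inequality. -/
def potentialDomain (b h : ℝ) : Prop :=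
  b ≤ 1 ∧ 0 ≤ h ∧ (-0.35 ≤ b ∧ -0.6 ≤ b - h ∧ h ≤ 0.55 ∨ 0.3 ≤ b ∧ -0.25 ≤ b - h ∧ h ≤ 0.76)

theorem potentialDomain.step {b h k : ℝ} (H : potentialDomain b h) (hk : 0 ≤ k) (hkh : k ≤ h)
    (hb : b + k ≤ 1) : potentialDomain (b + k) k := by
  obtain ⟨_, _, h1 | h1⟩ := H
  · exact ⟨hb, hk, Or.inl ⟨by linarith, by linarith, by linarith⟩⟩
  · exact ⟨hb, hk, Or.inr ⟨by linarith, by linarith, by linarith⟩⟩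

section
variable {b h x : ℝ}

theorem potential_le_of_le_neg (hb : -0.35 ≤ b) (hb' : b ≤ -0.05) (hh : 0 < h) (hbh : -0.6 ≤ b - h)
    (hx0 : 0 ≤ x) (hx1 : x ≤ 1) (hbx : b + h * x ≤ 1) :
    potential b h ≤ 2 * (h * x) * √((1 + b - h) * (1 - b)) + potential (b + h * x) (h * x) := by
  have h6 : 0 < b + 0.6 := by linarith
  have hy : h / (b + 0.6) * (b + 0.6) = h := by field_simp
  have hy0 : 0 ≤ h / (b + 0.6) := by positivity
  have hy1 : h / (b + 0.6) ≤ 1 := by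
    rw [div_le_one h6]; linarith
  refine potential_le_of_bellmanPoly (y := h / (b + 0.6)) (by norm_num) (by norm_num) (by norm_num)
    (by norm_num) (by norm_num) (by push_cast; linarith) hh hx0 hx1 (by linarith) hbx ?_ ?_
    (PExpr.eval_nonneg_of_certify₃ certify_bellman₁ (by norm_num) ?_ ?_ ?_)
  · have := mul_le_mul (by linarith : 0.4 ≤ 1 + b - h) (by linarith : 1 ≤ 1 - b) (by norm_num)
      (by linarith)
    push_cast
    linarith
  · simp only [PExpr.eval_add, PExpr.eval_mul, PExpr.eval_c, PExpr.eval_x,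
      Matrix.cons_val_zero, Matrix.cons_val]
    push_cast
    linarith
  all_goals push_cast; constructor <;> linarith

theorem potential_le_of_mid (hb : -0.05 ≤ b) (hb' : b ≤ 0.3) (hh : 0 < h)
    (hx0 : 0 ≤ x) (hx1 : x ≤ 1) (hbx : b + h * x ≤ 1) (h55 : h ≤ 0.55) :
    potential b h ≤ 2 * (h * x) * √((1 + b - h) * (1 - b)) + potential (b + h * x) (h * x) := by
  refine potential_le_of_bellmanPoly (y := h) (by norm_num) (by norm_num) (by norm_num)
    (by norm_num) (by norm_num) (by push_cast; linarith) hh hx0 hx1 (by linarith) hbx ?_ ?_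
    (PExpr.eval_nonneg_of_certify₃ certify_bellman₂ (by norm_num) ?_ ?_ ?_)
  · have h1 := mul_le_mul_of_nonneg_right (by linarith : 0.45 + b ≤ 1 + b - h)
      (by linarith : 0 ≤ 1 - b)
    have h2 := mul_nonneg (sub_nonneg.2 hb) (sub_nonneg.2 hb')
    push_cast
    linarith
  · simp only [PExpr.eval_mul, PExpr.eval_c, PExpr.eval_x, Matrix.cons_val]
    push_cast
    rfl
  all_goals push_cast; constructor <;> linarith

theorem potential_le_of_high (hb : 0.3 ≤ b) (hb' : b ≤ 0.8) (hh : 0 < h)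
    (hx0 : 0 ≤ x) (hx1 : x ≤ 1) (hbx : b + h * x ≤ 1) (h55 : h ≤ 0.55) :
    potential b h ≤ 2 * (h * x) * √((1 + b - h) * (1 - b)) + potential (b + h * x) (h * x) := by
  refine potential_le_of_bellmanPoly (y := h) (by norm_num) (by norm_num) (by norm_num)
    (by norm_num) (by norm_num) (by push_cast; linarith) hh hx0 hx1 (by linarith) hbx ?_ ?_
    (PExpr.eval_nonneg_of_certify₃ certify_bellman₃ (by norm_num) ?_ ?_ ?_)
  · have h1 := mul_le_mul_of_nonneg_right (by linarith : 0.45 + b ≤ 1 + b - h)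
      (by linarith : 0 ≤ 1 - b)
    have h2 := mul_nonneg (sub_nonneg.2 hb) (sub_nonneg.2 hb')
    push_cast
    linarith
  · simp only [PExpr.eval_mul, PExpr.eval_c, PExpr.eval_x, Matrix.cons_val]
    push_cast
    rfl
  all_goals push_cast; constructor <;> linarith

theorem potential_le_of_tall (hb' : b ≤ 0.51) (hbh : -0.25 ≤ b - h)
    (hx0 : 0 ≤ x) (hx1 : x ≤ 1) (hbx : b + h * x ≤ 1) (h55 : 0.55 < h) :
    potential b h ≤ 2 * (h * x) * √((1 + b - h) * (1 - b)) + potential (b + h * x) (h * x) := by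
  have h6 : 0 < b - 0.3 := by linarith
  have hy : (h - 0.55) / (b - 0.3) * (b - 0.3) = h - 0.55 := by field_simp
  have hy0 : 0 ≤ (h - 0.55) / (b - 0.3) := div_nonneg (by linarith) (by linarith)
  have hy1 : (h - 0.55) / (b - 0.3) ≤ 1 := by
    rw [div_le_one h6]; linarith
  refine potential_le_of_bellmanPoly (y := (h - 0.55) / (b - 0.3)) (by norm_num) (by norm_num)
    (by norm_num) (by norm_num) (by norm_num) (by push_cast; linarith) (by linarith) hx0 hx1
    (by linarith) hbx ?_ ?_
    (PExpr.eval_nonneg_of_certify₃ certify_bellman₄ (by norm_num) ?_ ?_ ?_)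
  · have := mul_le_mul (by linarith : 0.75 ≤ 1 + b - h) (by linarith : 0.49 ≤ 1 - b) (by norm_num)
      (by linarith)
    push_cast
    linarith
  · simp only [PExpr.eval_add, PExpr.eval_sub, PExpr.eval_mul, PExpr.eval_c, PExpr.eval_x,
      Matrix.cons_val_zero, Matrix.cons_val]
    push_cast
    linarith
  all_goals push_cast; constructor <;> linarith

theorem potential_le_of_tall_of_high (hb : 0.51 ≤ b) (hb' : b ≤ 0.8) (hx0 : 0 ≤ x) (hx1 : x ≤ 1)
    (hbx : b + h * x ≤ 1) (h55 : 0.55 < h) (h76 : h ≤ 0.76) :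
    potential b h ≤ 2 * (h * x) * √((1 + b - h) * (1 - b)) + potential (b + h * x) (h * x) := by
  refine potential_le_of_bellmanPoly (y := h) (by norm_num) (by norm_num) (by norm_num)
    (by norm_num) (by norm_num) (by push_cast; linarith) (by linarith) hx0 hx1 (by linarith) hbx
    ?_ ?_
    (PExpr.eval_nonneg_of_certify₃ certify_bellman₅ (by norm_num) ?_ ?_ ?_)
  · have h1 := mul_le_mul_of_nonneg_right (by linarith : 0.24 + b ≤ 1 + b - h)
      (by linarith : 0 ≤ 1 - b)
    have h2 := mul_nonneg (sub_nonneg.2 hb) (sub_nonneg.2 hb')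
    push_cast
    linarith
  · simp only [PExpr.eval_mul, PExpr.eval_c, PExpr.eval_x, Matrix.cons_val]
    push_cast
    rfl
  all_goals push_cast; constructor <;> linarith

theorem le_correctionGain_of_le_one (hh : 0 < h) (hx0 : 0 ≤ x) (hx1 : x ≤ 1)
    (hbx : b + h * x ≤ 1) : 0.16 * ((1 - b) * (1 - x ^ 2)) ≤ correctionGain b h x := by
  have h0 : 0 ≤ h * x := by positivity
  have h1 : x * (0.57 * (1 - b - h * x) ^ 3) ≤ 1 * (0.57 * (1 - b) ^ 3) := by
    have h2 : (1 - b - h * x) ^ 3 ≤ (1 - b) ^ 3 :=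
      pow_le_pow_left₀ (by linarith) (by linarith) 3
    have h3 : 0 ≤ (1 - b - h * x) ^ 3 := pow_nonneg (by linarith) 3
    exact mul_le_mul hx1 (by linarith) (by positivity) zero_le_one
  have h4 : 0 ≤ (0.57 * (1 - b) ^ 3 - x * (0.57 * (1 - b - h * x) ^ 3)) / h :=
    div_nonneg (by linarith) hh.le
  have h5 : 0 ≤ h * x ^ 3 / 12 := by positivity
  have h6 : 0 ≤ h * x * x ^ 2 := by positivity
  rw [correctionGain]
  linarith

theorem potential_le_of_near_one (hb : 0.8 ≤ b) (hb' : b < 1) (hh : 0 < h) (h76 : h ≤ 0.76)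
    (hx0 : 0 ≤ x) (hx1 : x ≤ 1) (hbx : b + h * x ≤ 1) :
    potential b h ≤ 2 * (h * x) * √((1 + b - h) * (1 - b)) + potential (b + h * x) (h * x) := by
  have hq : 0 < (1 + b - h) * (1 - b) := mul_pos (by linarith) (by linarith)
  refine potential_le_of_correctionGain (ε := 0) hh hx0 le_rfl (by linarith) hbx hq ?_
  have hg := le_correctionGain_of_le_one hh hx0 hx1 hbx
  have hx2 : 0 ≤ 1 - x ^ 2 := sub_nonneg.2 (pow_le_one₀ hx0 hx1)
  have hg0 : 0 ≤ 0.16 * ((1 - b) * (1 - x ^ 2)) :=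
    mul_nonneg (by norm_num) (mul_nonneg (by linarith) hx2)
  have hs : 2.28 * (1 - b) ≤ √((1 + b - h) * (1 - b)) := by
    apply le_sqrt_of_sq_le
    have h1 := mul_le_mul_of_nonneg_right (by linarith : 5.2 * (1 - b) ≤ 1 + b - h)
      (by linarith : 0 ≤ 1 - b)
    have h2 := sq_nonneg (1 - b)
    linarith
  have h0 : 0 ≤ x * (h * x ^ 2 / 4) := by positivity
  have h8 := mul_le_mul_of_nonneg_right hb (mul_nonneg hx0 hx0)
  rcases le_total 0.25 x with h1 | h1
  · have h2 : 0 ≤ correctionGain b h x * (1 + h * 0) * √((1 + b - h) * (1 - b)) := by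
      rw [mul_zero, add_zero, mul_one]
      exact mul_nonneg (hg0.trans hg) (sqrt_nonneg _)
    have h3 := mul_nonneg hx0 (by linarith : 0 ≤ 0.8 * x - (1 - b))
    linarith
  · have h2 : 0.15 * (1 - b) * (2.28 * (1 - b)) ≤
        correctionGain b h x * √((1 + b - h) * (1 - b)) := by
      have h4 : x ^ 2 ≤ 0.25 ^ 2 := pow_le_pow_left₀ hx0 h1 2
      have h5 := mul_le_mul_of_nonneg_left (by linarith : 0.9375 ≤ 1 - x ^ 2)
        (by linarith : 0 ≤ 1 - b)
      exact mul_le_mul (by linarith) hs (by linarith) (by linarith)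
    have h5 := sq_nonneg (1 - b - 1.6 * x)
    have h6 := sq_nonneg (1 - b)
    linarith

theorem potentialDomain.potential_le (H : potentialDomain b h) {k : ℝ} (hk : 0 ≤ k) (hkh : k ≤ h)
    (hbk : b + k ≤ 1) :
    potential b h ≤ 2 * k * √((1 + b - h) * (1 - b)) + potential (b + k) k := by
  obtain ⟨hb1, hh, hD⟩ := H
  rcases hh.eq_or_lt with rfl | hh
  · obtain rfl : k = 0 := le_antisymm hkh hk
    simp
  rcases hb1.eq_or_lt with rfl | hb1
  · obtain rfl : k = 0 := by linarith
    simp [potential_one]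
  obtain ⟨x, rfl⟩ : ∃ x, k = h * x := ⟨k / h, by field_simp⟩
  have hx0 : 0 ≤ x := nonneg_of_mul_nonneg_right hk hh
  have hx1 : x ≤ 1 := le_of_mul_le_mul_left (by linarith) hh
  rcases le_total 0.8 b with h8 | h8
  · exact potential_le_of_near_one h8 hb1 hh (by rcases hD with h | h <;> linarith) hx0 hx1 hbk
  rcases le_or_gt h 0.55 with h5 | h5
  · rcases le_total 0.3 b with h3 | h3
    · exact potential_le_of_high h3 h8 hh hx0 hx1 hbk h5
    rcases le_total b (-0.05) with h1 | h1
    · obtain ⟨h2, h4, -⟩ | ⟨h2, -⟩ := hD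
      · exact potential_le_of_le_neg h2 h1 hh h4 hx0 hx1 hbk
      · linarith
    · exact potential_le_of_mid h1 h3 hh hx0 hx1 hbk h5
  · obtain ⟨-, -, h2⟩ | ⟨-, h2, h4⟩ := hD
    · linarith
    rcases le_total b 0.51 with h1 | h1
    · exact potential_le_of_tall h1 h2 hx0 hx1 hbk h5
    · exact potential_le_of_tall_of_high h1 h8 hx0 hx1 hbk h5 h4

end

/-- A disk in the plane, given by the coordinates of its center and its radius. -/
structure Disk where
  x : ℝ
  y : ℝ
  r : ℝ

namespace Disk

/-- The disk lies in the unit disk. -/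
def Inside (d : Disk) : Prop := 0 ≤ d.r ∧ d.r ≤ 1 ∧ d.x ^ 2 + d.y ^ 2 ≤ (1 - d.r) ^ 2

/-- Two disks have disjoint interiors. -/
def Separated (d e : Disk) : Prop := (d.r + e.r) ^ 2 ≤ (d.x - e.x) ^ 2 + (d.y - e.y) ^ 2

/-- The list of diameters of a list of disks. -/
def diameters (P : List Disk) : List ℝ := P.map fun d => 2 * d.r

theorem separated_of_le_left {d e : Disk} (hd : 0 ≤ d.r) (he : 0 ≤ e.r)
    (h : d.x + d.r ≤ e.x - e.r) : d.Separated e := by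
  have h1 := pow_le_pow_left₀ (add_nonneg hd he) (by linarith : d.r + e.r ≤ e.x - d.x) 2
  have h2 := sq_nonneg (d.y - e.y)
  rw [Separated]
  linarith

theorem separated_of_le_below {d e : Disk} (hd : 0 ≤ d.r) (he : 0 ≤ e.r)
    (h : d.y + d.r ≤ e.y - e.r) : d.Separated e := by
  have h1 := pow_le_pow_left₀ (add_nonneg hd he) (by linarith : d.r + e.r ≤ e.y - d.y) 2
  have h2 := sq_nonneg (d.x - e.x)
  rw [Separated]
  linarith

end Disk

section
open Disk

/-- Disks with the given diameters can be packed into the part of the unit disk above `t`. -/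
def PacksAbove (t : ℝ) (L : List ℝ) : Prop :=
  ∃ P : List Disk, diameters P = L ∧ (∀ d ∈ P, d.Inside ∧ t ≤ d.y - d.r) ∧ P.Pairwise Separated

theorem PacksAbove.append {s t : ℝ} {P : List Disk} {L : List ℝ} (h : PacksAbove t L)
    (hP : ∀ d ∈ P, d.Inside ∧ s ≤ d.y - d.r ∧ d.y + d.r ≤ t) (hP' : P.Pairwise Separated)
    (hst : s ≤ t) : PacksAbove s (diameters P ++ L) := by
  obtain ⟨Q, rfl, hQ, hQ'⟩ := h
  refine ⟨P ++ Q, by simp [diameters], fun d hd => ?_, ?_⟩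
  · rcases List.mem_append.1 hd with hd | hd
    · exact ⟨(hP d hd).1, (hP d hd).2.1⟩
    · exact ⟨(hQ d hd).1, hst.trans (hQ d hd).2⟩
  · refine List.pairwise_append.2 ⟨hP', hQ', fun d hd e he => ?_⟩
    exact separated_of_le_below (hP d hd).1.1 (hQ e he).1.1 ((hP d hd).2.2.trans (hQ e he).2)

theorem exists_greedy_split {W : ℝ} (hW : 0 ≤ W) (L : List ℝ) :
    ∃ R T, L = R ++ T ∧ R.sum ≤ W ∧ ∀ k ∈ T.head?, W < R.sum + k := by
  induction L generalizing W with
  | nil => exact ⟨[], [], rfl, by simpa, by simp⟩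
  | cons a L ih =>
    rcases le_or_gt a W with h | h
    · obtain ⟨R, T, rfl, h1, h2⟩ := ih (sub_nonneg.2 h)
      refine ⟨a :: R, T, rfl, ?_, fun k hk => ?_⟩
      · rw [List.sum_cons]; linarith
      · have := h2 k hk
        rw [List.sum_cons]; linarith
    · exact ⟨[], a :: L, rfl, by simpa, by simpa⟩

theorem exists_row (R : List ℝ) (hR : ∀ a ∈ R, 0 ≤ a) (x₀ m : ℝ) :
    ∃ P : List Disk, diameters P = R ∧
      (∀ d ∈ P, d.y = m ∧ x₀ ≤ d.x - d.r ∧ d.x + d.r ≤ x₀ + R.sum) ∧ P.Pairwise Separated := by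
  induction R generalizing x₀ with
  | nil => exact ⟨[], rfl, by simp, .nil⟩
  | cons a R ih =>
    have ha : 0 ≤ a := hR a (by simp)
    have hR' : ∀ a ∈ R, 0 ≤ a := fun b hb => hR b (by simp [hb])
    obtain ⟨P, hP, h1, h2⟩ := ih hR' (x₀ + a)
    have hs : 0 ≤ R.sum := List.sum_nonneg hR'
    refine ⟨⟨x₀ + a / 2, m, a / 2⟩ :: P, ?_, ?_, ?_⟩
    · rw [diameters, List.map_cons, ← diameters, hP]
      congr 1
      ring
    · rintro d hd
      rw [List.sum_cons]
      rcases List.mem_cons.1 hd with rfl | hd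
      · exact ⟨rfl, by simp, by dsimp only; linarith⟩
      · obtain ⟨h3, h4, h5⟩ := h1 d hd
        exact ⟨h3, by linarith, by linarith⟩
    · refine List.pairwise_cons.2 ⟨fun d hd => ?_, h2⟩
      have hd' : 0 ≤ 2 * d.r := hR' _ (hP ▸ List.mem_map_of_mem hd)
      refine separated_of_le_left (by dsimp only; linarith) (by linarith) ?_
      dsimp only
      linarith [(h1 d hd).2.1]

theorem inside_of_mem_strip {d : Disk} {a h : ℝ} (hd : 0 ≤ d.r) (hdh : 2 * d.r ≤ h) (ha : -1 ≤ a)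
    (hb : a + h ≤ 1) (hy : d.y = a + h / 2)
    (h1 : -(√((1 + a) * (1 - (a + h))) + h / 2) ≤ d.x - d.r)
    (h2 : d.x + d.r ≤ √((1 + a) * (1 - (a + h))) + h / 2) : d.Inside := by
  have hq : 0 ≤ (1 + a) * (1 - (a + h)) := mul_nonneg (by linarith) (by linarith)
  have hX : √((1 + a) * (1 - (a + h))) ^ 2 = (1 + a) * (1 - (a + h)) := sq_sqrt hq
  have hX1 : √((1 + a) * (1 - (a + h))) ≤ 1 - h / 2 :=
    sqrt_le_iff.2 ⟨by linarith, by linarith [sq_nonneg (a + h / 2)]⟩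
  generalize √((1 + a) * (1 - (a + h))) = X at *
  have h3 : d.x ^ 2 ≤ (X + (h / 2 - d.r)) ^ 2 := sq_le_sq' (by linarith) (by linarith)
  have h4 := mul_nonneg (sub_nonneg.2 hX1) (by linarith : 0 ≤ h / 2 - d.r)
  refine ⟨hd, by linarith, ?_⟩
  rw [hy]
  linarith

theorem sq_add_le_sum_sq {k W : ℝ} {R : List ℝ} (hk : 0 ≤ k) (hR : ∀ a ∈ R, k ≤ a)
    (hW : W ≤ R.sum + k) : k * (W - k) ≤ (R.map (· ^ 2)).sum := by
  have h1 : k * R.sum ≤ (R.map (· ^ 2)).sum := by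
    clear hW
    induction R with
    | nil => simp
    | cons a R ih =>
      simp only [List.sum_cons, List.map_cons]
      have h2 := ih fun b hb => hR b (by simp [hb])
      have h3 := hR a (by simp)
      have h4 := mul_le_mul_of_nonneg_right h3 (hk.trans h3)
      linarith
  have h2 := mul_le_mul_of_nonneg_left hW hk
  linarith

theorem head_sq_le_sum {k : ℝ} {T : List ℝ} : k ^ 2 ≤ ((k :: T).map (· ^ 2)).sum := by
  simp only [List.map_cons, List.sum_cons]
  have : 0 ≤ (T.map (· ^ 2)).sum := List.sum_nonneg (by simp; intros; positivity)
  linarith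

theorem packsAbove_of_sum_lt {t h : ℝ} {L : List ℝ} (hL : (h :: L).Pairwise (· ≥ ·))
    (h0 : ∀ a ∈ h :: L, 0 ≤ a) (hD : potentialDomain (t + h) h)
    (hsum : ((h :: L).map (· ^ 2)).sum < h ^ 2 + potential (t + h) h) :
    PacksAbove t (h :: L) := by
  induction hn : L.length using Nat.strong_induction_on generalizing L t h with
  | _ n ih =>
  subst hn
  have hh : 0 ≤ h := hD.2.1
  have hb : t + h ≤ 1 := hD.1
  have ht : -1 ≤ t := by rcases hD.2.2 with h | h <;> linarith
  have hLh := (List.pairwise_cons.1 hL).1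
  set X := √((1 + t) * (1 - (t + h))) with hX
  have hX0 : 0 ≤ X := sqrt_nonneg _
  obtain ⟨R, T, rfl, hR, hT⟩ := exists_greedy_split (W := 2 * X) (by positivity) L
  obtain ⟨P, hP, hP1, hP2⟩ := exists_row (h :: R)
    (fun a ha => h0 a (by rw [← List.cons_append]; exact List.mem_append_left _ ha))
    (-(X + h / 2)) (t + h / 2)
  have hP3 : ∀ d ∈ P, d.Inside ∧ t ≤ d.y - d.r ∧ d.y + d.r ≤ t + h := fun d hd => by
    have h1 : 2 * d.r ∈ h :: R := hP ▸ List.mem_map_of_mem hd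
    have h2 : 0 ≤ d.r := by
      have := h0 (2 * d.r) (by rw [← List.cons_append]; exact List.mem_append_left _ h1)
      linarith
    have h3 : 2 * d.r ≤ h := by
      rcases List.mem_cons.1 h1 with h1 | h1
      · exact h1.le
      · exact hLh _ (List.mem_append_left _ h1)
    obtain ⟨h4, h5, h6⟩ := hP1 d hd
    rw [List.sum_cons] at h6
    exact ⟨inside_of_mem_strip h2 h3 ht hb h4 h5 (by linarith), by linarith, by linarith⟩
  suffices PacksAbove (t + h) T by
    have := this.append hP3 hP2 (by linarith)
    rwa [hP] at this
  cases T with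
  | nil => exact ⟨[], rfl, by simp, .nil⟩
  | cons k T =>
    have hk0 : 0 ≤ k := h0 k (by simp)
    have hkh : k ≤ h := hLh k (by simp)
    have hkR : ∀ a ∈ R, k ≤ a := fun a ha =>
      (List.pairwise_append.1 (List.pairwise_cons.1 hL).2).2.2 a ha k (by simp)
    have h1 := sq_add_le_sum_sq hk0 hkR (hT k (by simp)).le
    have h2 : ((h :: (R ++ k :: T)).map (· ^ 2)).sum =
        h ^ 2 + (R.map (· ^ 2)).sum + ((k :: T).map (· ^ 2)).sum := by
      simp only [List.map_cons, List.map_append, List.sum_cons, List.sum_append]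
      ring
    rw [h2] at hsum
    have hX' : X = √((1 + (t + h) - h) * (1 - (t + h))) := by rw [hX]; ring_nf
    rcases le_or_gt (t + h + k) 1 with h3 | h3
    · have h4 := hD.potential_le hk0 hkh h3
      rw [← hX'] at h4
      refine ih T.length (by simp; omega) (List.pairwise_append.1 (List.pairwise_cons.1 hL).2).2.1
        (fun a ha => h0 a (by simp; right; right; simpa using ha))
        (hD.step hk0 hkh h3) ?_ rfl
      linarith
    · have h4 := hD.potential_le (k := 1 - (t + h)) (by linarith) (by linarith) (by linarith)
      rw [← hX', add_sub_cancel, potential_one] at h4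
      have h5 := mul_le_mul_of_nonneg_right h3.le hX0
      have h6 := head_sq_le_sum (k := k) (T := T)
      linarith

end

section
open PExpr

/-- A polynomial lower bound for `h ^ 2 + potential b h`, up to scaling, in terms of `B = 20 * b`
and `H = 20 * h`. -/
def capacityPoly (B H : PExpr) : PExpr :=
  let E := c 20 - B
  c 301344000 - c 19200000 * B + B * B * B * (c 8000 + c 3 * B * B) - c 684 * H * E * E * E +
    c 480 * H * H * (c 1000 - c 8 * E)

theorem lt_of_capacityPoly {B H : PExpr} {b h S : ℝ} {v : Fin 3 → ℝ} (hB : eval v B = 20 * b)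
    (hH : eval v H = 20 * h) (hb : -0.35 ≤ b) (hb' : b ≤ 1)
    (hS : 192000000 * S ≤ eval v (capacityPoly B H)) : S < h ^ 2 + potential b h := by
  have h1 := le_capArea hb hb'
  have h2 : eval v (capacityPoly B H) = 192000000 * (h ^ 2 + (1.5705 - 2 * b + b ^ 3 / 3 + b ^ 5 / 20
      - 0.57 * h * (1 - b) ^ 3 - 0.16 * (1 - b) * h ^ 2) - 0.001) := by
    simp only [capacityPoly, eval_add, eval_sub, eval_mul, eval_c, hB, hH]
    push_cast
    ring
  rw [h2] at hS
  rw [potential]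
  linarith

/-- The first polynomial: side disks level with the top of the bottom disk. -/
def levelPoly : PExpr :=
  let s := x 0
  let H := c 20 * x 1
  capacityPoly (c 20 * (s - c 1) + H) H + c 192000000 * (s * s - c 2) + c 960000 * H * H

/-- The polynomial for two tilted disks of moderate size. -/
def tiltedPoly : PExpr :=
  let s := x 0
  let H := c 20 * x 1
  capacityPoly (c 20 * (s - c 1) + H) H + c 192000000 * (s * s - c 2) +
    c 48000000 * s * s * (c 2 - s) * (c 2 - s)

/-- The polynomial for two large tilted disks. -/
def largePoly : PExpr :=
  let s := x 0
  let H := c 20 * x 1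
  capacityPoly (c 20 * (s - c 1) + H) H + c 230400000 * s - c 346560000

/-- The polynomial for the case where the row height is at the lower end of its range. -/
def lowPoly (B : PExpr) : PExpr :=
  let H := c 20 * x 1
  capacityPoly B H + c 960000 * H * H - c 384000000

/-- The polynomial for three large disks. -/
def triplePoly : PExpr :=
  let s := x 0
  let g := x 1
  let H := c 40 * g * x 2
  let q := c 2 - s * (c 1 - g)
  capacityPoly (c 20 * (s - c 1) + H) H + c 192000000 * (c 4 * g * g - c 2) +
    c 48000000 * s * s * (c 4 * (c 1 - g) * (c 1 - g) + q * q)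

/-- The polynomial excluding three large disks that leave no room for a row. -/
def triplePoly' : PExpr :=
  let s := x 0
  let g := c 50 * (c 2 - s) * (c 1 - x 1) + c 41 * x 1
  let q := c 200 - s * (c 100 - g)
  s * s * (c 4 * (c 100 - g) * (c 100 - g) + q * q) + c 16 * g * g
    + c 40000 * (c 2 - s) * (c 2 - s) - c 80001

set_option maxRecDepth 100000 in
theorem certify_levelPoly : certify 250 400 levelPoly [0, 1, 0, 1]
    ![160, 0, 0] ![568, 200, 1] = true := by decide +kernel

set_option maxRecDepth 100000 in
theorem certify_tiltedPoly : certify 250 400 tiltedPoly [0, 1, 0, 1]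
    ![160, 0, 0] ![496, 148, 1] = true := by decide +kernel

set_option maxRecDepth 100000 in
theorem certify_largePoly : certify 250 400 largePoly [0, 1, 0, 1]
    ![414, 0, 0] ![602, 300, 1] = true := by decide +kernel

set_option maxRecDepth 100000 in
theorem certify_lowPoly₁ : certify 250 400 (lowPoly (c 20 * x 1 - c 12)) [1, 1]
    ![0, 100, 0] ![1, 200, 1] = true := by decide +kernel

set_option maxRecDepth 100000 in
theorem certify_lowPoly₂ : certify 250 400 (lowPoly (c (-7))) [1, 1]
    ![0, 0, 0] ![1, 100, 1] = true := by decide +kernel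

set_option maxRecDepth 100000 in
theorem certify_triplePoly : certify 250 400 triplePoly [0, 1, 0, 1, 0, 1, 0, 1, 0, 1, 0, 1]
    ![181, 74, 0] ![600, 164, 400] = true := by decide +kernel

set_option maxRecDepth 100000 in
theorem certify_triplePoly' : certify 250 400 triplePoly' [0, 1, 0, 1, 0, 1, 0, 1, 0, 1, 0, 1]
    ![472, 0, 0] ![800, 400, 1] = true := by decide +kernel
end

/-- Squared diameters of total at most `S`, the largest being `h ^ 2`, can be packed above `t`
according to the lower bound given by the potential. -/
def Fits (t h S : ℝ) : Prop :=
  ∃ t', t ≤ t' ∧ potentialDomain (t' + h) h ∧ S < h ^ 2 + potential (t' + h) h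

section
variable {t h S g : ℝ}

theorem fits_of_low (hlow : t < -0.6 ∨ t + h < -0.35) (h0 : 0 ≤ h) (h5 : h ≤ 0.5)
    (hS : S ≤ 2 - 2 * h ^ 2) : Fits t h S := by
  rcases le_total 0.25 h with h2 | h2
  · refine ⟨-0.6, ?_, ⟨by linarith, h0, Or.inl ⟨by linarith, by linarith, by linarith⟩⟩, ?_⟩
    · rcases hlow with h | h <;> linarith
    · have hp := PExpr.eval_nonneg_of_certify₃ certify_lowPoly₁ (by norm_num)
        (a := 0) (b := h) (c := 0) (by norm_num) (by constructor <;> push_cast <;> linarith)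
        (by norm_num)
      have hH : PExpr.eval ![0, h, 0] (PExpr.c 20 * PExpr.x 1) = 20 * h := by
        simp [PExpr.eval_mul, PExpr.eval_c, PExpr.eval_x]
      refine lt_of_capacityPoly (v := ![0, h, 0]) (B := PExpr.c 20 * PExpr.x 1 - PExpr.c 12)
        ?_ hH (by linarith) (by linarith) ?_
      · rw [PExpr.eval_sub, hH, PExpr.eval_c]
        push_cast
        linarith
      · simp only [lowPoly, PExpr.eval_add, PExpr.eval_sub, PExpr.eval_mul _ (_ * _),
          PExpr.eval_mul _ (PExpr.c 960000), hH, PExpr.eval_c] at hp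
        push_cast at hp
        linarith
  · refine ⟨-0.35 - h, ?_, ⟨by linarith, h0, Or.inl ⟨by linarith, by linarith, by linarith⟩⟩, ?_⟩
    · rcases hlow with h | h <;> linarith
    · have hp := PExpr.eval_nonneg_of_certify₃ certify_lowPoly₂ (by norm_num)
        (a := 0) (b := h) (c := 0) (by norm_num) (by constructor <;> push_cast <;> linarith)
        (by norm_num)
      have hH : PExpr.eval ![0, h, 0] (PExpr.c 20 * PExpr.x 1) = 20 * h := by
        simp [PExpr.eval_mul, PExpr.eval_c, PExpr.eval_x]
      refine lt_of_capacityPoly (v := ![0, h, 0]) (B := PExpr.c (-7))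
        ?_ hH (by linarith) (by linarith) ?_
      · rw [PExpr.eval_c]
        push_cast
        linarith
      · simp only [lowPoly, PExpr.eval_add, PExpr.eval_sub, PExpr.eval_mul _ (_ * _),
          PExpr.eval_mul _ (PExpr.c 960000), hH, PExpr.eval_c] at hp
        push_cast at hp
        linarith

/-- The polynomial expressions for `20 * b` and `20 * h` when `b = s - 1 + h` with `s = x 0` and
`h = x 1`. -/
theorem eval_level_args (s h : ℝ) :
    PExpr.eval ![s, h, 0] (PExpr.c 20 * (PExpr.x 0 - PExpr.c 1) + PExpr.c 20 * PExpr.x 1) =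
      20 * (s - 1 + h) ∧ PExpr.eval ![s, h, 0] (PExpr.c 20 * PExpr.x 1) = 20 * h := by
  constructor
  · simp only [PExpr.eval_add, PExpr.eval_sub, PExpr.eval_mul, PExpr.eval_c, PExpr.eval_x,
      Matrix.cons_val_zero, Matrix.cons_val_one]
    push_cast
    ring
  · simp [PExpr.eval_mul, PExpr.eval_c, PExpr.eval_x]

theorem fits_of_level {s : ℝ} (h0 : 0 ≤ h) (h5 : h ≤ 0.5)
    (hS : S ≤ 2 - s ^ 2 - 2 * h ^ 2) (hS' : h ^ 2 ≤ S) : Fits (s - 1) h S := by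
  by_cases hlow : s - 1 < -0.6 ∨ s - 1 + h < -0.35
  · exact fits_of_low hlow h0 h5 (by linarith [sq_nonneg s])
  · push Not at hlow
    have h3 := sq_nonneg h
    have hs' : s ≤ 1.42 := abs_le_of_sq_le_sq' (by linarith) (by norm_num) |>.2
    have hb : s - 1 + h ≤ 1 := by linarith [sq_nonneg (s - 3 * h), sq_nonneg (s + h - 2)]
    refine ⟨s - 1, le_rfl, ⟨hb, h0, Or.inl ⟨hlow.2, by linarith, by linarith⟩⟩, ?_⟩
    obtain ⟨hB, hH⟩ := eval_level_args s h
    have hp := PExpr.eval_nonneg_of_certify₃ certify_levelPoly (by norm_num)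
      (a := s) (b := h) (c := 0) (by constructor <;> push_cast <;> linarith)
      (by constructor <;> push_cast <;> linarith) (by norm_num)
    refine lt_of_capacityPoly hB hH hlow.2 hb ?_
    rw [levelPoly] at hp
    simp only [PExpr.eval_add _ (_ + _), PExpr.eval_add _ (capacityPoly _ _), PExpr.eval_sub,
      PExpr.eval_mul _ (_ * _), PExpr.eval_mul _ (PExpr.c 960000),
      PExpr.eval_mul _ (PExpr.c 192000000), PExpr.eval_mul _ (PExpr.x _), hH, PExpr.eval_c,
      PExpr.eval_x, Matrix.cons_val_zero] at hp
    push_cast at hp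
    linarith

theorem fits_of_tilted {s : ℝ} (hs' : s ≤ 1.24) (h0 : 0 ≤ h) (h5 : h ≤ 0.37)
    (hS : S ≤ 2 - s ^ 2 * (1 + (1 - s / 2) ^ 2)) (hS' : S ≤ 2 - 2 * h ^ 2) :
    Fits (s - 1) h S := by
  by_cases hlow : s - 1 < -0.6 ∨ s - 1 + h < -0.35
  · exact fits_of_low hlow h0 (by linarith) hS'
  · push Not at hlow
    have hb : s - 1 + h ≤ 1 := by linarith
    refine ⟨s - 1, le_rfl, ⟨hb, h0, Or.inl ⟨hlow.2, by linarith, by linarith⟩⟩, ?_⟩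
    obtain ⟨hB, hH⟩ := eval_level_args s h
    have hp := PExpr.eval_nonneg_of_certify₃ certify_tiltedPoly (by norm_num)
      (a := s) (b := h) (c := 0) (by constructor <;> push_cast <;> linarith)
      (by constructor <;> push_cast <;> linarith) (by norm_num)
    refine lt_of_capacityPoly hB hH hlow.2 hb ?_
    rw [tiltedPoly] at hp
    simp only [PExpr.eval_add _ (_ + _), PExpr.eval_add _ (capacityPoly _ _), PExpr.eval_sub,
      PExpr.eval_mul _ (_ * _), PExpr.eval_mul _ (PExpr.c 48000000),
      PExpr.eval_mul _ (PExpr.c 192000000), PExpr.eval_mul _ (PExpr.x _), PExpr.eval_c,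
      PExpr.eval_x, Matrix.cons_val_zero] at hp
    push_cast at hp
    linarith

theorem fits_of_large {s : ℝ} (hs : 1.036 ≤ s) (h0 : 0 ≤ h) (hS : S ≤ 1.805 - 1.2 * s)
    (hS' : h ^ 2 ≤ S) : Fits (s - 1) h S := by
  have h75 : h ≤ 0.75 := abs_le_of_sq_le_sq' (by linarith) (by norm_num) |>.2
  have hb : h ≤ 2 - s := by
    have h3 := sq_nonneg h
    refine abs_le_of_sq_le_sq' ?_ (by linarith) |>.2
    linarith [sq_nonneg (s - 1.4)]
  refine ⟨s - 1, le_rfl, ⟨by linarith, h0, ?_⟩, ?_⟩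
  · rcases le_total h 0.55 with h1 | h1
    · exact Or.inl ⟨by linarith, by linarith, h1⟩
    · exact Or.inr ⟨by linarith, by linarith, by linarith⟩
  obtain ⟨hB, hH⟩ := eval_level_args s h
  have hp := PExpr.eval_nonneg_of_certify₃ certify_largePoly (by norm_num)
    (a := s) (b := h) (c := 0) (by constructor <;> push_cast <;> linarith [sq_nonneg h])
    (by constructor <;> push_cast <;> linarith) (by norm_num)
  refine lt_of_capacityPoly hB hH (by linarith) (by linarith) ?_
  rw [largePoly] at hp
  simp only [PExpr.eval_add _ (capacityPoly _ _), PExpr.eval_sub,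
    PExpr.eval_mul _ (PExpr.c 230400000), PExpr.eval_c,
    PExpr.eval_x, Matrix.cons_val_zero] at hp
  push_cast at hp
  linarith

theorem lt_of_two_lt_add {s : ℝ} (hs0 : 1.181 ≤ s) (hs : s ≤ 2) (hsg : 2 ≤ s + 2 * g)
    (hg : g ≤ 0.41) :
    2 < s ^ 2 * ((1 - g) ^ 2 + (1 - s * (1 - g) / 2) ^ 2) + 4 * g ^ 2 + (2 - s) ^ 2 := by
  have h1 : 0 < 0.41 - (2 - s) / 2 := by linarith
  obtain ⟨y, hy⟩ : ∃ y, y * (0.41 - (2 - s) / 2) = g - (2 - s) / 2 :=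
    ⟨(g - (2 - s) / 2) / (0.41 - (2 - s) / 2), div_mul_cancel₀ _ h1.ne'⟩
  have hy0 : 0 ≤ y := nonneg_of_mul_nonneg_left (by linarith) h1
  have hy1 : y ≤ 1 := le_of_mul_le_mul_right (by linarith) h1
  have hp := PExpr.eval_nonneg_of_certify₃ certify_triplePoly' (by norm_num)
    (a := s) (b := y) (c := 0) (by constructor <;> push_cast <;> linarith)
    (by constructor <;> push_cast <;> linarith) (by norm_num)
  have hg' : 50 * (2 - s) * (1 - y) + 41 * y = 100 * g := by linarith
  simp only [triplePoly', PExpr.eval_add, PExpr.eval_sub, PExpr.eval_mul, PExpr.eval_c,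
    PExpr.eval_x, Matrix.cons_val_zero, Matrix.cons_val_one] at hp
  push_cast at hp
  rw [hg'] at hp
  linarith

theorem fits_of_triple {s : ℝ} (hs : 0.4525 ≤ s) (hs' : s ≤ 1.5) (hg : 0.185 ≤ g)
    (hsg : 2 * g ≤ s * (1 - g)) (h0 : 0 ≤ h) (hhg : h ≤ 2 * g) (hS' : h ^ 2 ≤ S)
    (hS : S ≤ 2 - 4 * g ^ 2 - s ^ 2 * ((1 - g) ^ 2 + (1 - s * (1 - g) / 2) ^ 2))
    (hSg : S ≤ 2 - 12 * g ^ 2) : Fits (s - 1) h S := by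
  have hh2 : h ^ 2 ≤ (2 * g) ^ 2 := pow_le_pow_left₀ h0 hhg 2
  have h3 := sq_nonneg h
  have hg4 : g ≤ 0.409 := abs_le_of_sq_le_sq' (by linarith) (by norm_num) |>.2
  rcases lt_or_ge (s - 1 + h) (-0.35) with hlow | hlow
  · exact fits_of_low (Or.inr hlow) h0 (by linarith) (by linarith)
  have hb : s - 1 + h ≤ 1 := by
    by_contra! hb
    have h4 := lt_of_two_lt_add (s := s) (g := g) (by linarith) (by linarith) (by linarith)
      (by linarith)
    have h5 : (2 - s) ^ 2 ≤ h ^ 2 := pow_le_pow_left₀ (by linarith) (by linarith) 2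
    linarith
  refine ⟨s - 1, le_rfl, ⟨hb, h0, ?_⟩, ?_⟩
  · rcases le_or_gt h 0.55 with h1 | h1
    · exact Or.inl ⟨hlow, by linarith, h1⟩
    · have h7 : h ≤ 0.71 := abs_le_of_sq_le_sq' (by linarith) (by norm_num) |>.2
      have h8 := mul_le_mul_of_nonneg_left (by linarith : 1 - g ≤ 0.725) (by linarith : 0 ≤ s)
      exact Or.inr ⟨by linarith, by linarith, by linarith⟩
  have hg0 : 0 < g := by linarith
  obtain ⟨y, rfl⟩ : ∃ y, h = 2 * g * y := ⟨h / (2 * g), by field_simp⟩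
  have hy0 : 0 ≤ y := nonneg_of_mul_nonneg_right h0 (by positivity)
  have hy1 : y ≤ 1 := le_of_mul_le_mul_left (a := 2 * g) (by linarith) (by positivity)
  have hp := PExpr.eval_nonneg_of_certify₃ certify_triplePoly (by norm_num)
    (a := s) (b := g) (c := y) (by constructor <;> push_cast <;> linarith)
    (by constructor <;> push_cast <;> linarith) (by constructor <;> push_cast <;> linarith)
  have hH : PExpr.eval ![s, g, y] (PExpr.c 40 * PExpr.x 1 * PExpr.x 2) = 20 * (2 * g * y) := by
    simp only [PExpr.eval_mul, PExpr.eval_c, PExpr.eval_x, Matrix.cons_val_one, Matrix.cons_val]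
    push_cast
    ring
  have hB : PExpr.eval ![s, g, y] (PExpr.c 20 * (PExpr.x 0 - PExpr.c 1) +
      PExpr.c 40 * PExpr.x 1 * PExpr.x 2) = 20 * (s - 1 + 2 * g * y) := by
    rw [PExpr.eval_add, hH]
    simp only [PExpr.eval_sub, PExpr.eval_mul, PExpr.eval_c, PExpr.eval_x, Matrix.cons_val_zero]
    push_cast
    ring
  refine lt_of_capacityPoly hB hH hlow hb ?_
  rw [triplePoly] at hp
  simp only [PExpr.eval_add _ (_ + _), PExpr.eval_add _ (capacityPoly _ _),
    PExpr.eval_add _ (_ * _), PExpr.eval_sub,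
    PExpr.eval_mul _ (_ * _), PExpr.eval_mul _ (PExpr.c 192000000), PExpr.eval_mul _ (_ - _),
    PExpr.eval_mul _ (PExpr.c 48000000), PExpr.eval_mul _ (PExpr.x _), PExpr.eval_mul _ (PExpr.c 4),
    PExpr.eval_c, PExpr.eval_x, Matrix.cons_val_zero, Matrix.cons_val_one] at hp
  push_cast at hp
  linarith

end

theorem inside_level {q s : ℝ} (hq : 0 ≤ q) (hqs : 2 * q ≤ s) (hs : s ≤ 2) {x : ℝ}
    (hx : x ^ 2 = (2 - s) * (s - 2 * q)) : Disk.Inside ⟨x, s - 1 - q, q⟩ := by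
  refine ⟨hq, ?_, ?_⟩ <;> dsimp only
  · linarith
  · rw [hx]
    exact le_of_eq (by ring)

open Disk in
theorem packsAbove_of_fits {P : List Disk} {t h S : ℝ} {L : List ℝ}
    (hP : ∀ d ∈ P, d.Inside ∧ d.y + d.r ≤ t) (hP' : P.Pairwise Separated)
    (hL : (h :: L).Pairwise (· ≥ ·)) (h0 : ∀ a ∈ h :: L, 0 ≤ a)
    (hS : ((h :: L).map (· ^ 2)).sum ≤ S) (hF : Fits t h S) :
    PacksAbove (-1) (diameters P ++ h :: L) := by
  obtain ⟨t', ht, hD, hS'⟩ := hF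
  refine (packsAbove_of_sum_lt hL h0 hD (hS.trans_lt hS')).append (fun d hd => ?_) hP'
    (by rcases hD.2.2 with h | h <;> linarith)
  obtain ⟨h1, h2⟩ := hP d hd
  refine ⟨h1, ?_, h2.trans ht⟩
  have h3 := (abs_le_of_sq_le_sq' (a := d.y) (b := 1 - d.r)
    (by linarith [h1.2.2, sq_nonneg d.x]) (by linarith [h1.2.1])).1
  linarith

section
open Disk

variable {p q q' s : ℝ}

/-- The disk of radius `p` touching the bottom of the unit disk. -/
noncomputable def bottomDisk (p : ℝ) : Disk := ⟨0, -(1 - p), p⟩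

/-- The disk of radius `q` touching the unit disk from the inside on the left, and the level
`s - 1` from below. -/
noncomputable def leftDisk (s q : ℝ) : Disk := ⟨-√((2 - s) * (s - 2 * q)), s - 1 - q, q⟩

/-- The disk of radius `q` touching the unit disk from the inside on the right, and the level
`s - 1` from below. -/
noncomputable def rightDisk (s q : ℝ) : Disk := ⟨√((2 - s) * (s - 2 * q)), s - 1 - q, q⟩

theorem inside_bottomDisk (hp : 0 ≤ p) (hps : 2 * p ≤ s) (hs : s ≤ 2) :
    (bottomDisk p).Inside ∧ (bottomDisk p).y + (bottomDisk p).r ≤ s - 1 :=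
  ⟨⟨hp, by dsimp [bottomDisk]; linarith, by dsimp [bottomDisk]; linarith⟩,
    by dsimp [bottomDisk]; linarith⟩

theorem inside_leftDisk (hq : 0 ≤ q) (hqs : 2 * q ≤ s) (hs : s ≤ 2) :
    (leftDisk s q).Inside ∧ (leftDisk s q).y + (leftDisk s q).r ≤ s - 1 := by
  refine ⟨inside_level hq hqs hs ?_, by dsimp [leftDisk]; linarith⟩
  rw [neg_sq, sq_sqrt (mul_nonneg (by linarith) (by linarith))]

theorem inside_rightDisk (hq : 0 ≤ q) (hqs : 2 * q ≤ s) (hs : s ≤ 2) :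
    (rightDisk s q).Inside ∧ (rightDisk s q).y + (rightDisk s q).r ≤ s - 1 := by
  refine ⟨inside_level hq hqs hs ?_, by dsimp [rightDisk]; linarith⟩
  rw [sq_sqrt (mul_nonneg (by linarith) (by linarith))]

theorem _root_.Disk.Separated.symm {d e : Disk} (h : d.Separated e) : e.Separated d := by
  rw [Separated] at h ⊢
  linarith

theorem separated_bottomDisk_leftDisk (hqs : 2 * q ≤ s) (hs : s ≤ 2)
    (hqp : 2 * q ≤ s * (1 - p)) : (bottomDisk p).Separated (leftDisk s q) := by
  have := sq_sqrt (mul_nonneg (by linarith : 0 ≤ 2 - s) (by linarith : 0 ≤ s - 2 * q))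
  dsimp only [Separated, bottomDisk, leftDisk]
  linarith

theorem separated_bottomDisk_rightDisk (hqs : 2 * q ≤ s) (hs : s ≤ 2)
    (hqp : 2 * q ≤ s * (1 - p)) : (bottomDisk p).Separated (rightDisk s q) := by
  have := sq_sqrt (mul_nonneg (by linarith : 0 ≤ 2 - s) (by linarith : 0 ≤ s - 2 * q))
  dsimp only [Separated, bottomDisk, rightDisk]
  linarith

theorem separated_leftDisk_rightDisk
    (h : 4 * (q * q') ≤ (√((2 - s) * (s - 2 * q)) + √((2 - s) * (s - 2 * q'))) ^ 2) :
    (leftDisk s q).Separated (rightDisk s q') := by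
  dsimp only [Separated, leftDisk, rightDisk]
  linarith

theorem separated_leftDisk_rightDisk_of_sq_le (hq' : 0 ≤ q') (hqq' : q' ≤ q) (hs : s ≤ 2)
    (h : q ^ 2 ≤ (2 - s) * (s - 2 * q)) : (leftDisk s q).Separated (rightDisk s q') := by
  apply separated_leftDisk_rightDisk
  have h1 : q ≤ √((2 - s) * (s - 2 * q)) := le_sqrt_of_sq_le h
  have h2 : q ≤ √((2 - s) * (s - 2 * q')) := by
    refine le_sqrt_of_sq_le (h.trans ?_)
    exact mul_le_mul_of_nonneg_left (by linarith) (by linarith)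
  have h3 := pow_le_pow_left₀ (by linarith) (add_le_add h1 h2) 2
  have h4 := mul_le_mul_of_nonneg_left hqq' (hq'.trans hqq')
  linarith

theorem separated_leftDisk_rightDisk_of_mul_le (hqq' : q' ≤ q) (hqs : 2 * q ≤ s) (hs : s ≤ 2)
    (h : 2 * (q * q') ≤ (2 - s) * (2 * s - 3 * q - q')) :
    (leftDisk s q).Separated (rightDisk s q') := by
  apply separated_leftDisk_rightDisk
  have h1 := sq_sqrt (mul_nonneg (by linarith : 0 ≤ 2 - s) (by linarith : 0 ≤ s - 2 * q))
  have h2 := sq_sqrt (mul_nonneg (by linarith : 0 ≤ 2 - s) (by linarith : 0 ≤ s - 2 * q'))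
  have h3 : √((2 - s) * (s - 2 * q)) ≤ √((2 - s) * (s - 2 * q')) :=
    sqrt_le_sqrt (mul_le_mul_of_nonneg_left (by linarith) (by linarith))
  have h4 := mul_le_mul_of_nonneg_left h3 (sqrt_nonneg ((2 - s) * (s - 2 * q)))
  linarith

end

section
open Disk

variable {r₁ r₂ v : ℝ}

theorem exists_tilted_pair (hr₂ : 0 ≤ r₂) (hr : r₂ ≤ r₁) (hr₁ : r₁ ≤ 1) (hv : 0 < v)
    (hσ : r₁ + r₂ = v * (2 - v)) :
    ∃ d e : Disk, diameters [d, e] = [2 * r₁, 2 * r₂] ∧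
      (∀ a ∈ [d, e], a.Inside ∧ a.y + a.r ≤ 2 - 2 * (r₁ * r₂) / v ^ 2 - 1) ∧ d.Separated e := by
  have hp : √(r₁ * r₂) ^ 2 = r₁ * r₂ := sq_sqrt (mul_nonneg (hr₂.trans hr) hr₂)
  have hr₁' : r₁ = v * (2 - v) - r₂ := by linarith
  refine ⟨⟨-(√(r₁ * r₂) * (1 - (r₁ - r₂) / v ^ 2)), 2 - 2 * (r₁ * r₂) / v ^ 2 - 1 - r₁, r₁⟩,
    ⟨√(r₁ * r₂) * (1 + (r₁ - r₂) / v ^ 2), 2 - 2 * (r₁ * r₂) / v ^ 2 - 1 - r₂, r₂⟩, rfl, ?_, ?_⟩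
  · simp only [List.mem_cons, List.not_mem_nil, or_false, forall_eq_or_imp, forall_eq]
    refine ⟨⟨⟨hr₂.trans hr, hr₁, ?_⟩, by linarith⟩, ⟨hr₂, hr.trans hr₁, ?_⟩, by linarith⟩ <;>
      dsimp only
    · rw [neg_sq, mul_pow, hp]
      refine le_of_eq ?_
      rw [hr₁']
      field_simp
      ring
    · rw [mul_pow, hp]
      refine le_of_eq ?_
      rw [hr₁']
      field_simp
      ring
  · dsimp only [Separated]
    refine le_of_eq ?_
    linear_combination (-4) * hp

end

section
open PExpr

/-- The lower bound for the squared radii of a tilted pair, in terms of `v = x 0`, `F = x 1`. -/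
def tiltedPairPoly : PExpr :=
  let v := x 0
  let F := x 1
  let w := c 4 - c 4 * v + F * v * v
  (c 8 - F * v) * (c 16 + w * w) - c 256 * v + c 128 * v * v - c 16 * F * v * v * v

/-- The linear lower bound for the squared radii of a large tilted pair, in terms of `v = x 0` and
`F = x 1`. -/
def largePairPoly : PExpr :=
  let v := x 0
  let F := x 1
  c 800 * v * v * (c 2 - c 2 * v + v * v) - c 400 * F * v * v * v * v
    - c 480 * v + c 120 * F * v * v - c 39

/-- The condition for a pair of disks on top of a smaller one to be disjoint, in terms of
`r₂ = x 0` and parameters for `r₁` and `r₃`. -/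
def triplePairPoly : PExpr :=
  let b := c 400 * x 0
  let a := b + (c 340 - c 2 * b) * x 1
  let g := c 74 + (b - c 74) * x 2
  (c 400 - g - a) * (a * (c 400 + c 3 * g) - b * (c 400 - g)) * c 400
    - a * b * (c 400 - g) * (c 400 - g)

set_option maxRecDepth 100000 in
theorem certify_tiltedPairPoly : certify 250 400 tiltedPairPoly [0, 1, 0, 1]
    ![0, 0, 0] ![246, 400, 1] = true := by decide +kernel

set_option maxRecDepth 100000 in
theorem certify_largePairPoly : certify 250 400 largePairPoly
    [0, 0, 0, 0, 0, 0, 0, 0] ![245, 0, 0] ![400, 400, 1] = true := by decide +kernel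

set_option maxRecDepth 100000 in
theorem certify_triplePairPoly : certify 250 400 triplePairPoly
    [0, 1, 2, 0, 1, 2, 0, 1, 2, 0, 1, 2] ![74, 0, 0] ![170, 400, 400] = true := by decide +kernel

end

theorem le_sum_sq_of_tilted {v F : ℝ} (hv : 0 ≤ v) (hv' : v ≤ 0.615) (hF : 0 ≤ F) (hF' : F ≤ 1) :
    (2 * v - F * v ^ 2 / 2) ^ 2 * (1 + (1 - (2 * v - F * v ^ 2 / 2) / 2) ^ 2) ≤
      4 * v ^ 2 * (2 - 2 * v + v ^ 2) - 2 * F * v ^ 4 := by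
  have hp := PExpr.eval_nonneg_of_certify₃ certify_tiltedPairPoly (by norm_num)
    (a := v) (b := F) (c := 0) (by constructor <;> push_cast <;> linarith)
    (by constructor <;> push_cast <;> linarith) (by norm_num)
  have h3 := mul_nonneg (mul_nonneg hF (pow_nonneg hv 3)) hp
  simp only [tiltedPairPoly, PExpr.eval_add, PExpr.eval_sub, PExpr.eval_mul, PExpr.eval_c,
    PExpr.eval_x, Matrix.cons_val_zero, Matrix.cons_val_one] at h3
  push_cast at h3
  linarith

theorem le_sum_sq_of_large {v F : ℝ} (hv : 0.6125 ≤ v) (hv' : v ≤ 1) (hF : 0 ≤ F) (hF' : F ≤ 1) :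
    1.2 * (2 * v - F * v ^ 2 / 2) + 0.195 ≤
      4 * v ^ 2 * (2 - 2 * v + v ^ 2) - 2 * F * v ^ 4 := by
  have hp := PExpr.eval_nonneg_of_certify₃ certify_largePairPoly (by norm_num)
    (a := v) (b := F) (c := 0) (by constructor <;> push_cast <;> linarith)
    (by constructor <;> push_cast <;> linarith) (by norm_num)
  simp only [largePairPoly, PExpr.eval_add, PExpr.eval_sub, PExpr.eval_mul, PExpr.eval_c,
    PExpr.eval_x, Matrix.cons_val_zero, Matrix.cons_val_one] at hp
  push_cast at hp
  linarith

theorem triplePair_le {a b g : ℝ} (hg : 0.185 ≤ g) (hgb : g ≤ b) (hba : b ≤ a)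
    (hab : a + b ≤ 0.85) :
    a * b * (1 - g) ^ 2 ≤ (1 - g - a) * (a * (1 + 3 * g) - b * (1 - g)) := by
  have hsub {u w : ℝ} (hu : 0 ≤ u) (huw : u ≤ w) : ∃ z, 0 ≤ z ∧ z ≤ 1 ∧ w * z = u := by
    rcases (hu.trans huw).eq_or_lt with h | h
    · exact ⟨0, le_rfl, zero_le_one, by linarith⟩
    · exact ⟨u / w, by positivity, (div_le_one h).2 huw, by field_simp⟩
  obtain ⟨y, hy0, hy1, hy⟩ := hsub (sub_nonneg.2 hba) (by linarith : a - b ≤ 0.85 - 2 * b)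
  obtain ⟨z, hz0, hz1, hz⟩ := hsub (sub_nonneg.2 hg) (by linarith : g - 0.185 ≤ b - 0.185)
  have hp := PExpr.eval_nonneg_of_certify₃ certify_triplePairPoly (by norm_num)
    (a := b) (b := y) (c := z) (by constructor <;> push_cast <;> linarith)
    (by constructor <;> push_cast <;> linarith) (by constructor <;> push_cast <;> linarith)
  simp only [triplePairPoly, PExpr.eval_add, PExpr.eval_sub, PExpr.eval_mul, PExpr.eval_c,
    PExpr.eval_x, Matrix.cons_val_zero, Matrix.cons_val_one, Matrix.cons_val] at hp
  push_cast at hp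
  have hy' : 400 * b + (340 - 2 * (400 * b)) * y = 400 * a := by linarith
  have hz' : 74 + (400 * b - 74) * z = 400 * g := by linarith
  rw [hy', hz'] at hp
  linarith

section
open Disk

variable {r₁ r₂ r₃ h S : ℝ} {L : List ℝ}

/-- The disks of radii `r₁`, `r₂`, `r₃` can be packed below the level `s - 1`, at the bottom, on the
left and on the right. -/
theorem exists_triple {p q q' s : ℝ} (hp : 0 ≤ p) (hq' : 0 ≤ q') (hqq' : q' ≤ q) (hps : 2 * p ≤ s)
    (hs : s ≤ 2) (hqp : 2 * q ≤ s * (1 - p))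
    (h : (leftDisk s q).Separated (rightDisk s q')) :
    (∀ d ∈ [bottomDisk p, leftDisk s q, rightDisk s q'], d.Inside ∧ d.y + d.r ≤ s - 1) ∧
      [bottomDisk p, leftDisk s q, rightDisk s q'].Pairwise Separated := by
  have h1 := mul_nonneg (by linarith : 0 ≤ s) hp
  have hqs : 2 * q ≤ s := by linarith
  simp only [List.mem_cons, List.not_mem_nil, or_false, forall_eq_or_imp, forall_eq,
    List.pairwise_cons, List.Pairwise.nil, IsEmpty.forall_iff, implies_true, and_true]
  exact ⟨⟨inside_bottomDisk hp hps hs, inside_leftDisk (by linarith) hqs hs,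
    inside_rightDisk hq' (by linarith) hs⟩, ⟨separated_bottomDisk_leftDisk hqs hs hqp,
    separated_bottomDisk_rightDisk (by linarith) hs (by linarith)⟩, h⟩

theorem packs_of_small_second (hr₁ : r₂ ≤ r₁) (hr₂ : r₃ ≤ r₂) (hr₃ : h ≤ 2 * r₃) (hh : 0 ≤ h)
    (hr : r₂ ≤ r₁ * (1 - r₁)) (hL : (h :: L).Pairwise (· ≥ ·)) (h0 : ∀ a ∈ h :: L, 0 ≤ a)
    (hS : ((h :: L).map (· ^ 2)).sum ≤ 2 - 4 * (r₁ ^ 2 + r₂ ^ 2 + r₃ ^ 2)) :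
    PacksAbove (-1) (2 * r₁ :: 2 * r₂ :: 2 * r₃ :: h :: L) := by
  have hS0 := head_sq_le_sum (k := h) (T := L)
  have h1 : r₁ ≤ 1 := abs_le_of_sq_le_sq' (by
    linarith [sq_nonneg h, sq_nonneg r₂, sq_nonneg r₃]) (by norm_num) |>.2
  have hh2 : h ^ 2 ≤ (2 * r₂) ^ 2 := pow_le_pow_left₀ hh (by linarith) 2
  have hh3 : h ^ 2 ≤ (2 * r₃) ^ 2 := pow_le_pow_left₀ hh (by linarith) 2
  have h4 : h ≤ 0.5 := by linarith [sq_nonneg (r₁ - 1 / 2)]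
  have h5 : r₂ ^ 2 ≤ (2 - 2 * r₁) * (2 * r₁ - 2 * r₂) := by
    have h6 := pow_le_pow_left₀ (by linarith) hr 2
    have h7 := mul_le_mul_of_nonneg_left (by linarith : r₁ ^ 2 ≤ r₁ - r₂)
      (by linarith : 0 ≤ 1 - r₁)
    have h8 := mul_nonneg (sq_nonneg r₁) (mul_nonneg (by linarith : 0 ≤ 1 - r₁)
      (by linarith : 0 ≤ 3 + r₁))
    linarith
  obtain ⟨hP, hP'⟩ := exists_triple (p := r₁) (q := r₂) (q' := r₃) (s := 2 * r₁) (by linarith)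
    (by linarith) hr₂ le_rfl (by linarith) (by linarith)
    (separated_leftDisk_rightDisk_of_sq_le (by linarith) hr₂ (by linarith) h5)
  exact packsAbove_of_fits hP hP' hL h0 hS
    (fits_of_level hh h4 (by linarith) (hS0.trans hS))

theorem fits_of_triple_radii {s : ℝ} (hr₁ : r₂ ≤ r₁) (hr₂ : r₃ ≤ r₂) (hr₃ : h ≤ 2 * r₃) (hh : 0 ≤ h)
    (hσ : r₁ + r₂ ≤ 0.85) (hg : 0.185 ≤ r₃) (hs : s ≤ 1.5) (hsg : 2 * r₃ ≤ s * (1 - r₃))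
    (h₁ : s * (1 - r₃) ≤ 2 * r₁) (h₂ : s * (1 - r₁) ≤ 2 * r₂)
    (hS : h ^ 2 ≤ 2 - 4 * (r₁ ^ 2 + r₂ ^ 2 + r₃ ^ 2)) :
    Fits (s - 1) h (2 - 4 * (r₁ ^ 2 + r₂ ^ 2 + r₃ ^ 2)) := by
  have hs0 : 0.4525 ≤ s := by
    have h0 : 0 ≤ s := (pos_of_mul_pos_left (b := 1 - r₃) (by linarith) (by linarith)).le
    linarith [mul_le_mul_of_nonneg_left hg h0]
  refine fits_of_triple hs0 hs hg hsg hh hr₃ hS ?_ ?_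
  · have h3 : 2 * r₂ ≥ s * (1 - r₁) ∧ 0 ≤ s * (1 - r₁) :=
      ⟨h₂, mul_nonneg (by linarith) (by linarith)⟩
    have h4 := pow_le_pow_left₀ h3.2 h3.1 2
    have h5 : s * (1 - s * (1 - r₃) / 2) ≤ 2 * (1 - r₃) := by
      have h6 := mul_le_mul_of_nonneg_left (by linarith : 1 / 2 ≤ 1 - r₃)
        (by positivity : 0 ≤ 2 + s ^ 2 / 2)
      linarith [sq_nonneg (1 - s / 2)]
    have h7 := mul_le_mul_of_nonneg_left h5 (by linarith : 0 ≤ s)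
    have h8 := mul_nonneg (sub_nonneg.2 h₁) (sub_nonneg.2 h7)
    have h9 := mul_nonneg (mul_self_nonneg (r₁ - s * (1 - r₃) / 2)) (by positivity : 0 ≤ 4 + s ^ 2)
    linarith
  · have h3 := pow_le_pow_left₀ (by linarith) hr₂ 2
    have h4 := pow_le_pow_left₀ (by linarith) hr₁ 2
    linarith

theorem packs_of_triple (hr₁ : r₂ ≤ r₁) (hr₂ : r₃ ≤ r₂) (hr₃ : h ≤ 2 * r₃) (hh : 0 ≤ h)
    (hσ : r₁ + r₂ ≤ 0.85) (hg : 0.185 ≤ r₃) (hr : r₁ * (1 - r₁) ≤ r₂)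
    (hL : (h :: L).Pairwise (· ≥ ·)) (h0 : ∀ a ∈ h :: L, 0 ≤ a)
    (hS : ((h :: L).map (· ^ 2)).sum ≤ 2 - 4 * (r₁ ^ 2 + r₂ ^ 2 + r₃ ^ 2)) :
    PacksAbove (-1) (2 * r₁ :: 2 * r₂ :: 2 * r₃ :: h :: L) := by
  have hS0 := (head_sq_le_sum (k := h) (T := L)).trans hS
  obtain ⟨s, hs⟩ : ∃ s, s * (1 - r₁) = 2 * r₂ :=
    ⟨2 * r₂ / (1 - r₁), div_mul_cancel₀ _ (by linarith)⟩
  obtain ⟨s', hs'⟩ : ∃ s', s' * (1 - r₃) = 2 * r₁ :=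
    ⟨2 * r₁ / (1 - r₃), div_mul_cancel₀ _ (by linarith)⟩
  have hs0 : 0 ≤ s := (pos_of_mul_pos_left (b := 1 - r₁) (by linarith) (by linarith)).le
  have hs0' : 0 ≤ s' := (pos_of_mul_pos_left (b := 1 - r₃) (by linarith) (by linarith)).le
  have hs1 : s ≤ 1.5 := by
    by_contra! h1
    have := mul_le_mul h1.le (by linarith : 0.15 + r₂ ≤ 1 - r₁) (by linarith) hs0
    linarith
  rcases le_total s s' with hss | hss
  · have h1 := mul_le_mul_of_nonneg_left (by linarith : 1 - r₁ ≤ 1 - r₃) hs0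
    have h2 := mul_le_mul_of_nonneg_right hss (by linarith : 0 ≤ 1 - r₃)
    have h3 : 2 * r₁ ≤ s := le_of_mul_le_mul_right (a := 1 - r₁) (by linarith) (by linarith)
    have h4 : r₂ ^ 2 ≤ (2 - s) * (s - 2 * r₂) := by
      have h5 := mul_nonneg hs0 (by linarith : 0 ≤ r₁)
      have h6 := mul_le_mul_of_nonneg_right (by linarith : 2 * r₂ ≤ s) (by linarith : 0 ≤ r₁)
      have h7 := mul_le_mul (by linarith : 0.5 ≤ 2 - s) (by linarith : 2 * r₂ * r₁ ≤ s - 2 * r₂) ?_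
        (by linarith)
      · linarith [mul_le_mul_of_nonneg_left hr₁ (by linarith : 0 ≤ r₂)]
      · exact mul_nonneg (by linarith) (by linarith)
    obtain ⟨hP, hP'⟩ := exists_triple (p := r₁) (q := r₂) (q' := r₃) (s := s) (by linarith)
      (by linarith) hr₂ h3 (by linarith) hs.ge
      (separated_leftDisk_rightDisk_of_sq_le (by linarith) hr₂ (by linarith) h4)
    exact packsAbove_of_fits hP hP' hL h0 hS (fits_of_triple_radii hr₁ hr₂ hr₃ hh hσ hg hs1
      (by linarith) (by linarith) hs.le hS0)
  · have h1 := mul_le_mul_of_nonneg_right hss (by linarith : 0 ≤ 1 - r₁)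
    have h2 := mul_nonneg hs0' (by linarith : 0 ≤ r₃)
    have h4 : 2 * (r₁ * r₂) ≤ (2 - s') * (2 * s' - 3 * r₁ - r₂) := by
      have h5 := triplePair_le hg hr₂ hr₁ hσ
      have h6 : (1 - r₃ - r₁) * (r₁ * (1 + 3 * r₃) - r₂ * (1 - r₃)) =
          (2 - s') * (2 * s' - 3 * r₁ - r₂) / 2 * (1 - r₃) ^ 2 := by
        have h7 : (2 - s') * (1 - r₃) = 2 * (1 - r₃ - r₁) := by linarith
        have h8 : (2 * s' - 3 * r₁ - r₂) * (1 - r₃) = r₁ * (1 + 3 * r₃) - r₂ * (1 - r₃) := by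
          linarith
        linear_combination (-(2 * s' - 3 * r₁ - r₂) * (1 - r₃) / 2) * h7 - (1 - r₃ - r₁) * h8
      rw [h6] at h5
      have h7 := le_of_mul_le_mul_right h5 (pow_pos (by linarith) 2)
      linarith
    obtain ⟨hP, hP'⟩ := exists_triple (p := r₃) (q := r₁) (q' := r₂) (s := s') (by linarith)
      (by linarith) hr₁ (by linarith) (by linarith) hs'.ge
      (separated_leftDisk_rightDisk_of_mul_le hr₁ (by linarith) (by linarith) h4)
    refine packsAbove_of_fits (P := [leftDisk s' r₁, rightDisk s' r₂, bottomDisk r₃])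
      (fun d hd => hP d ?_) ?_ hL h0 hS (fits_of_triple_radii hr₁ hr₂ hr₃ hh hσ hg
      (hss.trans hs1) (by linarith) hs'.le (by linarith) hS0)
    · simp only [List.mem_cons, List.not_mem_nil, or_false] at hd ⊢
      tauto
    · simp only [List.pairwise_cons, List.mem_cons, List.not_mem_nil, or_false, forall_eq_or_imp,
        forall_eq, List.Pairwise.nil, IsEmpty.forall_iff, implies_true, and_true] at hP' ⊢
      exact ⟨⟨hP'.2, hP'.1.1.symm⟩, hP'.1.2.symm⟩

theorem sub_le_sq_of_mul_le {v : ℝ} (hr₁ : 0 ≤ r₁) (hr₁' : r₁ ≤ 1) (hr₂ : 0 ≤ r₂) (hv : 0 ≤ v)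
    (hσ : r₁ + r₂ = v * (2 - v)) (hr : r₁ * (1 - r₁) ≤ r₂) : r₁ - r₂ ≤ v ^ 2 := by
  by_contra! hd
  have he : √(r₁ - r₂) ^ 2 = r₁ - r₂ := sq_sqrt ((sq_nonneg v).trans hd.le)
  have he1 : √(r₁ - r₂) ≤ 1 := sqrt_le_one.2 (by linarith)
  have hve : v < √(r₁ - r₂) := (lt_sqrt hv).2 hd
  have h1 : r₁ < √(r₁ - r₂) := by
    have := mul_pos (sub_pos.2 hve) (by linarith : 0 < 2 - v - √(r₁ - r₂))
    linarith
  have h2 := pow_lt_pow_left₀ h1 hr₁ two_ne_zero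
  linarith

theorem packs_of_tilted (hr₁ : r₂ ≤ r₁) (hr₂ : h ≤ 2 * r₂) (hh : 0 ≤ h)
    (hr₁' : 0 < r₁) (hr : r₁ * (1 - r₁) ≤ r₂) (hor : 0.85 ≤ r₁ + r₂ ∨ r₁ + r₂ ≤ 0.85 ∧ h ≤ 0.37)
    (hL : (h :: L).Pairwise (· ≥ ·)) (h0 : ∀ a ∈ h :: L, 0 ≤ a)
    (hS : ((h :: L).map (· ^ 2)).sum ≤ 2 - 4 * (r₁ ^ 2 + r₂ ^ 2)) :
    PacksAbove (-1) (2 * r₁ :: 2 * r₂ :: h :: L) := by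
  have hS0 := (head_sq_le_sum (k := h) (T := L)).trans hS
  have hh2 := sq_nonneg h
  have hσ1 : r₁ + r₂ ≤ 1 := (abs_le_of_sq_le_sq' (by
    linarith [sq_nonneg (r₁ - r₂)]) zero_le_one).2
  obtain ⟨v, hv0, hv1, hv⟩ : ∃ v, 0 < v ∧ v ≤ 1 ∧ r₁ + r₂ = v * (2 - v) := by
    refine ⟨1 - √(1 - (r₁ + r₂)), ?_, by linarith [sqrt_nonneg (1 - (r₁ + r₂))], ?_⟩
    · rw [sub_pos, sqrt_lt' one_pos]
      linarith
    · linarith [sq_sqrt (by linarith : 0 ≤ 1 - (r₁ + r₂))]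
  have hdv := sub_le_sq_of_mul_le hr₁'.le (by linarith) (by linarith) hv0.le hv hr
  obtain ⟨D, hD⟩ : ∃ D, r₁ - r₂ = D * v ^ 2 := ⟨(r₁ - r₂) / v ^ 2, by field_simp⟩
  have hv2 : 0 < v ^ 2 := by positivity
  have hD0 : 0 ≤ D := nonneg_of_mul_nonneg_left (by linarith) hv2
  have hD1 : D ≤ 1 := le_of_mul_le_mul_right (by linarith) hv2
  have hF0 : 0 ≤ 1 - D ^ 2 := sub_nonneg.2 (pow_le_one₀ hD0 hD1)
  have hF1 : 1 - D ^ 2 ≤ 1 := by linarith [sq_nonneg D]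
  obtain ⟨d, e, hde, hP, hP'⟩ := exists_tilted_pair (by linarith) hr₁ (by linarith) hv0 hv
  have hr₁e : r₁ = (v * (2 - v) + D * v ^ 2) / 2 := by linarith
  have hr₂e : r₂ = (v * (2 - v) - D * v ^ 2) / 2 := by linarith
  have hs : 2 - 2 * (r₁ * r₂) / v ^ 2 = 2 * v - (1 - D ^ 2) * v ^ 2 / 2 := by
    rw [hr₁e, hr₂e]
    field_simp
    ring
  have hsum : 4 * (r₁ ^ 2 + r₂ ^ 2) =
      4 * v ^ 2 * (2 - 2 * v + v ^ 2) - 2 * (1 - D ^ 2) * v ^ 4 := by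
    rw [hr₁e, hr₂e]
    ring
  rw [hs] at hP
  have key : Fits (2 * v - (1 - D ^ 2) * v ^ 2 / 2 - 1) h (2 - 4 * (r₁ ^ 2 + r₂ ^ 2)) := by
    clear hr₁e hr₂e hs
    have h3 := mul_le_mul_of_nonneg_right hF1 hv2.le
    have h4 := mul_nonneg hF0 hv2.le
    rcases hor with h1 | ⟨h1, h2⟩
    · have hv' : 0.6125 ≤ v := by
        by_contra! h5
        have := mul_pos (sub_pos.2 h5) (by linarith : 0 < 2 - v - 0.6125)
        linarith
      have h5 := le_sum_sq_of_large hv' hv1 hF0 hF1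
      refine fits_of_large ?_ hh (by linarith) hS0
      have := mul_nonneg (sub_nonneg.2 hv') (sub_nonneg.2 hv1)
      linarith
    · have hv' : v ≤ 0.615 := by
        by_contra! h5
        have := mul_nonneg (sub_nonneg.2 h5.le) (by linarith : 0 ≤ 2 - v - 0.615)
        linarith
      have h5 := le_sum_sq_of_tilted hv0.le hv' hF0 hF1
      have h6 := pow_le_pow_left₀ hh hr₂ 2
      have h7 := pow_le_pow_left₀ hh (hr₂.trans (by linarith : 2 * r₂ ≤ 2 * r₁)) 2
      exact fits_of_tilted (by linarith) hh h2 (by linarith) (by linarith)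
  have := packsAbove_of_fits hP (by simpa using hP') hL h0 hS key
  rwa [hde] at this

theorem packs_of_four_le_length {L : List ℝ} (hlen : 4 ≤ L.length) (hL : L.Pairwise (· ≥ ·))
    (h0 : ∀ a ∈ L, 0 ≤ a) (hS : (L.map (· ^ 2)).sum ≤ 2) : PacksAbove (-1) L := by
  match L, hlen with
  | a :: b :: g :: h :: L, _ =>
  obtain ⟨r₁, rfl⟩ : ∃ r, a = 2 * r := ⟨a / 2, by ring⟩
  obtain ⟨r₂, rfl⟩ : ∃ r, b = 2 * r := ⟨b / 2, by ring⟩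
  obtain ⟨r₃, rfl⟩ : ∃ r, g = 2 * r := ⟨g / 2, by ring⟩
  have hb := (List.pairwise_cons.1 hL).1 (2 * r₂) (by simp)
  have hL₁ := (List.pairwise_cons.1 hL).2
  have hg := (List.pairwise_cons.1 hL₁).1 (2 * r₃) (by simp)
  have hL₂ := (List.pairwise_cons.1 hL₁).2
  have hh := (List.pairwise_cons.1 hL₂).1 h (by simp)
  have hL₃ := (List.pairwise_cons.1 hL₂).2
  have hh0 : 0 ≤ h := h0 h (by simp)
  have h0₂ : ∀ a ∈ 2 * r₃ :: h :: L, 0 ≤ a := fun a ha =>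
    h0 a (List.mem_cons_of_mem _ (List.mem_cons_of_mem _ ha))
  have h0₃ : ∀ a ∈ h :: L, 0 ≤ a := fun a ha => h0₂ a (List.mem_cons_of_mem _ ha)
  have hS₂ : ((2 * r₃ :: h :: L).map (· ^ 2)).sum ≤ 2 - 4 * (r₁ ^ 2 + r₂ ^ 2) := by
    simp only [List.map_cons, List.sum_cons] at hS ⊢
    linarith
  have hS₃ : ((h :: L).map (· ^ 2)).sum ≤ 2 - 4 * (r₁ ^ 2 + r₂ ^ 2 + r₃ ^ 2) := by
    simp only [List.map_cons, List.sum_cons] at hS ⊢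
    linarith
  rcases le_or_gt r₂ (r₁ * (1 - r₁)) with h1 | h1
  · exact packs_of_small_second (by linarith) (by linarith) hh hh0 h1 hL₃ h0₃ hS₃
  have hr₁ : 0 < r₁ := by
    rcases (by linarith : 0 ≤ r₁).eq_or_lt with rfl | h
    · linarith
    · exact h
  rcases le_total 0.85 (r₁ + r₂) with h2 | h2
  · exact packs_of_tilted (by linarith) hg (by linarith) hr₁ h1.le (Or.inl h2) hL₂ h0₂ hS₂
  rcases le_total r₃ 0.185 with h3 | h3
  · exact packs_of_tilted (by linarith) hg (by linarith) hr₁ h1.le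
      (Or.inr ⟨h2, by linarith⟩) hL₂ h0₂ hS₂
  · exact packs_of_triple (by linarith) (by linarith) hh hh0 h2 h3 h1.le hL₃ h0₃ hS₃

theorem exists_centers {ι : Type*} {r : ι → ℝ} {l : List ι} {L : List ℝ} {t : ℝ}
    (h : PacksAbove t (l.map (fun i => 2 * r i) ++ L)) :
    ∃ c : ι → EuclideanSpace ℝ (Fin 2), (∀ i ∈ l, ‖c i‖ ≤ 1 - r i) ∧
      (∀ i ∈ l, ∀ j ∈ l, i ≠ j → r i + r j ≤ ‖c i - c j‖) := by
  classical
  obtain ⟨P, hP, hP1, hP2⟩ := h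
  have hlen : P.length = l.length + L.length := by
    have := congrArg List.length hP
    simpa [diameters] using this
  have hD (i : ι) (hi : i ∈ l) : ∃ d : Disk, ∃ hlt : l.idxOf i < P.length,
      d = P[l.idxOf i] ∧ d.r = r i := by
    have h1 : l.idxOf i < l.length := List.idxOf_lt_length_iff.2 hi
    have h2 : l.idxOf i < P.length := by omega
    refine ⟨_, h2, rfl, ?_⟩
    have h3 : (diameters P)[l.idxOf i]? = (l.map (fun i => 2 * r i) ++ L)[l.idxOf i]? := by
      rw [hP]
    rw [diameters, List.getElem?_map, List.getElem?_eq_getElem h2,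
      List.getElem?_append_left (by simpa using h1), List.getElem?_map,
      List.getElem?_eq_getElem h1, List.getElem_idxOf h1] at h3
    simpa using h3
  have : Nonempty Disk := ⟨⟨0, 0, 0⟩⟩
  choose! d hlt hd hr using hD
  have hsep (i j : ι) (hi : i ∈ l) (hj : j ∈ l) (hij : l.idxOf i < l.idxOf j) :
      (d i).Separated (d j) := by
    rw [hd i hi, hd j hj]
    exact List.pairwise_iff_getElem.1 hP2 _ _ _ _ hij
  refine ⟨fun i => !₂[(d i).x, (d i).y], fun i hi => ?_, fun i hi j hj hij => ?_⟩
  · have h1 : (d i).Inside := by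
      rw [hd i hi]
      exact (hP1 _ (List.getElem_mem _)).1
    rw [EuclideanSpace.norm_eq]
    refine sqrt_le_iff.2 ⟨?_, ?_⟩
    · rw [← hr i hi]
      linarith [h1.2.1]
    · simpa [hr i hi] using h1.2.2
  · have h1 : (d i).Separated (d j) := by
      rcases lt_trichotomy (l.idxOf i) (l.idxOf j) with h | h | h
      · exact hsep i j hi hj h
      · exact absurd ((List.idxOf_inj hi).1 h) hij
      · exact (hsep j i hj hi h).symm
    rw [EuclideanSpace.norm_eq]
    refine le_sqrt_of_sq_le ?_
    simpa [Separated, hr i hi, hr j hj] using h1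

end

/-- Every finite family of disks whose total area is at most half the area of
the unit disk can be packed into the unit disk. -/
theorem disks_pack_into_unit_disk {ι : Type*} (I : Finset ι) (r : ι → ℝ)
    (hpos : ∀ i ∈ I, 0 < r i)
    (harea : ∑ i ∈ I, π * r i ^ 2 ≤ π / 2) :
    ∃ c : ι → EuclideanSpace ℝ (Fin 2),
      (∀ i ∈ I, ‖c i‖ ≤ 1 - r i) ∧
      (∀ i ∈ I, ∀ j ∈ I, i ≠ j → r i + r j ≤ ‖c i - c j‖) := by
  set l := I.toList.insertionSort fun i j => r j ≤ r i
  have hperm : l.Perm I.toList := List.perm_insertionSort _ _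
  have hmem (i : ι) : i ∈ l ↔ i ∈ I := by rw [hperm.mem_iff, Finset.mem_toList]
  have hsorted : l.Pairwise fun i j => r j ≤ r i := List.pairwise_insertionSort _ _
  have hsum : (l.map fun i => (2 * r i) ^ 2).sum ≤ 2 := by
    rw [(hperm.map _).sum_eq, Finset.sum_map_toList]
    rw [← Finset.mul_sum, div_eq_mul_one_div, mul_le_mul_iff_right₀ pi_pos] at harea
    simp only [mul_pow]
    rw [← Finset.mul_sum]
    linarith
  have h := packs_of_four_le_length (L := l.map (fun i => 2 * r i) ++ [0, 0, 0, 0]) (by simp) ?_ ?_ ?_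
  · obtain ⟨c, hc, hc'⟩ := exists_centers h
    simp only [hmem] at hc hc'
    exact ⟨c, hc, hc'⟩
  · refine List.pairwise_append.2 ⟨?_, by simp, fun a ha b hb => ?_⟩
    · exact List.pairwise_map.2 (hsorted.imp fun h => by linarith)
    · obtain ⟨i, hi, rfl⟩ := List.mem_map.1 ha
      obtain rfl : b = 0 := by simpa using hb
      linarith [hpos i ((hmem i).1 hi)]
  · intro a ha
    rcases List.mem_append.1 ha with ha | ha
    · obtain ⟨i, hi, rfl⟩ := List.mem_map.1 ha
      linarith [hpos i ((hmem i).1 hi)]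
    · exact (by simpa using ha : a = 0).ge
  · simpa [Function.comp_def] using hsum
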